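/- Frequency-localized commutator estimate in ℝ^{2+1}. Let s ∈ (4/7, 1) and let ε > 0 be sufficiently small; then there exist ε' > 0 and C = C(s, ε, m₁) such that the following holds for all N ≥ 1 and δ ∈ (0,1]. Let N₁, N₂, N₃, N₄ be dyadic numbers with N_i = 2^{k_i}, k_i ∈ {0,1,2,...}, and let φ₁, ..., φ₄ be Schwartz functions on ℝ² × ℝ whose spatial Fourier transforms are nonnegative and, for each t, supported in {ξ : N_i ≤ ⟨ξ⟩ ≤ 2N_i}. Then |∫₀^δ ∫_{ξ₁+ξ₂+ξ₃+ξ₄=0} (1 − m_N(ξ₂+ξ₃+ξ₄)/(m_N(ξ₂) m_N(ξ₃) m_N(ξ₄))) φ̂₁(ξ₁,t) φ̂₂(ξ₂,t) φ̂₃(ξ₃,t) φ̂₄(ξ₄,t) dt| ≤ C N^{−3/2 + ε} (N₁N₂N₃N₄)^{−ε'} ‖φ₁‖_{X_{−1, 1/2+ε}} ‖φ₂‖_{X_{1, 1/2+ε}} ‖φ₃‖_{X_{1, 1/2+ε}} ‖φ₄‖_{X_{1, 1/2+ε}}. -/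

import Mathlib

open MeasureTheory Complex Set
open scoped FourierTransform BigOperators RealInnerProductSpace

noncomputable section

abbrev Rn (n : ℕ) := EuclideanSpace ℝ (Fin n)

/-- Japanese bracket of a vector. -/
def jap {n : ℕ} (ξ : Rn n) : ℝ := Real.sqrt (1 + ‖ξ‖ ^ 2)

/-- Japanese bracket of a real number. -/
def japR (x : ℝ) : ℝ := Real.sqrt (1 + x ^ 2)

/-- Inhomogeneous Sobolev norm ‖⟨ξ⟩^s f̂‖_{L²}. -/
def sobNorm (n : ℕ) (s : ℝ) (f : Rn n → ℂ) : ℝ :=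
  (∫ ξ : Rn n, jap ξ ^ (2 * s) * ‖𝓕 f ξ‖ ^ 2) ^ (1/2 : ℝ)

/-- Homogeneous Sobolev norm ‖|ξ|^s f̂‖_{L²}. -/
def sobNormHom (n : ℕ) (s : ℝ) (f : Rn n → ℂ) : ℝ :=
  (∫ ξ : Rn n, ‖ξ‖ ^ (2 * s) * ‖𝓕 f ξ‖ ^ 2) ^ (1/2 : ℝ)

/-- L^p norm on ℝⁿ. -/
def lpNorm (n : ℕ) (p : ℝ) (f : Rn n → ℂ) : ℝ :=
  (∫ x : Rn n, ‖f x‖ ^ p) ^ (1/p)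

/-- Laplacian: sum of second partial derivatives. -/
def laplacian {n : ℕ} (f : Rn n → ℂ) (x : Rn n) : ℂ :=
  ∑ i : Fin n, fderiv ℝ (fun y => fderiv ℝ f y (EuclideanSpace.single i 1)) x
    (EuclideanSpace.single i 1)

/-- Complex gradient as a vector in Euclidean space. -/
def gradC {n : ℕ} (f : Rn n → ℂ) (x : Rn n) : EuclideanSpace ℂ (Fin n) :=
  (WithLp.equiv 2 (Fin n → ℂ)).symm fun i => fderiv ℝ f x (EuclideanSpace.single i 1)

/-- φ is a solution of the cubic defocussing NLS on ℝⁿ × [0,T] with data φ₀: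
smooth, Schwartz in x uniformly for t ∈ [0,T] (with all derivatives),
satisfying i∂ₜφ + Δφ = |φ|²φ and φ(·,0) = φ₀. -/
def IsNLSSolution (n : ℕ) (T : ℝ) (φ : Rn n → ℝ → ℂ) (φ₀ : Rn n → ℂ) : Prop :=
  ContDiff ℝ (⊤ : ℕ∞) (fun p : Rn n × ℝ => φ p.1 p.2) ∧
  (∀ k l : ℕ, ∃ C : ℝ, ∀ t ∈ Icc (0:ℝ) T, ∀ x : Rn n,
      ‖x‖ ^ k * ‖iteratedFDeriv ℝ l (fun y => φ y t) x‖ ≤ C) ∧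
  (∀ x : Rn n, ∀ t ∈ Icc (0:ℝ) T,
      Complex.I * deriv (fun t' => φ x t') t + laplacian (fun y => φ y t) x
        = (‖φ x t‖ : ℂ) ^ 2 * φ x t) ∧
  (∀ x : Rn n, φ x 0 = φ₀ x)

/-- The energy E(f) = ∫ (1/2)|∇f|² + (1/4)|f|⁴. -/
def energy {n : ℕ} (f : Rn n → ℂ) : ℝ :=
  ∫ x : Rn n, ((1/2 : ℝ) * ∑ i : Fin n, ‖fderiv ℝ f x (EuclideanSpace.single i 1)‖ ^ 2
    + (1/4 : ℝ) * ‖f x‖ ^ 4)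

/-- m₁ is a smooth, radially symmetric, nonincreasing multiplier with
m₁ = 1 on the unit ball, m₁(ξ) = |ξ|^{-(1-s)} for |ξ| ≥ 2, 0 < m₁ ≤ 1. -/
def IsAdmissibleMultiplier (n : ℕ) (s : ℝ) (m₁ : Rn n → ℝ) : Prop :=
  ContDiff ℝ (⊤ : ℕ∞) m₁ ∧
  (∀ ξ : Rn n, 0 < m₁ ξ ∧ m₁ ξ ≤ 1) ∧
  (∀ ξ η : Rn n, ‖ξ‖ = ‖η‖ → m₁ ξ = m₁ η) ∧
  (∀ ξ η : Rn n, ‖ξ‖ ≤ ‖η‖ → m₁ η ≤ m₁ ξ) ∧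
  (∀ ξ : Rn n, ‖ξ‖ ≤ 1 → m₁ ξ = 1) ∧
  (∀ ξ : Rn n, 2 ≤ ‖ξ‖ → m₁ ξ = ‖ξ‖ ^ (-(1 - s)))

/-- The rescaled multiplier m_N(ξ) = m₁(ξ/N). -/
def mN {n : ℕ} (m₁ : Rn n → ℝ) (N : ℝ) (ξ : Rn n) : ℝ := m₁ (N⁻¹ • ξ)

/-- The smoothing operator I_N with Fourier multiplier m_N. -/
def Iop {n : ℕ} (m₁ : Rn n → ℝ) (N : ℝ) (f : Rn n → ℂ) : Rn n → ℂ :=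
  fun x => 𝓕⁻ (fun ξ => (mN m₁ N ξ : ℂ) * 𝓕 f ξ) x

/-- The spatial multiplier ⟨∇⟩^s. -/
def japMul (n : ℕ) (s : ℝ) (f : Rn n → ℂ) : Rn n → ℂ :=
  fun x => 𝓕⁻ (fun ξ => ((jap ξ ^ s : ℝ) : ℂ) * 𝓕 f ξ) x

/-- Sharp Littlewood–Paley projection onto {M ≤ ⟨ξ⟩ ≤ 2M}. -/
def LP (n : ℕ) (M : ℝ) (f : Rn n → ℂ) : Rn n → ℂ :=
  fun x => 𝓕⁻ (fun ξ => if M ≤ jap ξ ∧ jap ξ ≤ 2 * M then 𝓕 f ξ else 0) x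

/-- Space-time Fourier transform ψ̃(ξ,τ). -/
def stFourier (n : ℕ) {E : Type*} [NormedAddCommGroup E] [NormedSpace ℂ E]
    (ψ : Rn n → ℝ → E) (ξ : Rn n) (τ : ℝ) : E :=
  ∫ x : Rn n, ∫ t : ℝ,
    Complex.exp (Complex.I * ((-2 * Real.pi * (⟪x, ξ⟫ + t * τ) : ℝ) : ℂ)) • ψ x t

/-- The X_{s,b} norm ‖⟨ξ⟩^s ⟨τ-|ξ|²⟩^b ψ̃‖_{L²}. -/
def XNorm (n : ℕ) {E : Type*} [NormedAddCommGroup E] [NormedSpace ℂ E]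
    (s b : ℝ) (ψ : Rn n → ℝ → E) : ℝ :=
  (∫ ξ : Rn n, ∫ τ : ℝ,
    jap ξ ^ (2 * s) * japR (τ - ‖ξ‖ ^ 2) ^ (2 * b) * ‖stFourier n ψ ξ τ‖ ^ 2) ^ (1/2 : ℝ)

/-- The restricted norm X^δ_{s,b}: infimum over Schwartz extensions off ℝⁿ × [0,δ]. -/
def XRNorm (n : ℕ) {E : Type*} [NormedAddCommGroup E] [NormedSpace ℂ E]
    (s b δ : ℝ) (f : Rn n → ℝ → E) : ℝ :=
  sInf { r : ℝ | ∃ ψ : SchwartzMap (Rn n × ℝ) E,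
    (∀ x : Rn n, ∀ t ∈ Icc (0:ℝ) δ, ψ (x, t) = f x t) ∧
    r = XNorm n s b (fun x t => ψ (x, t)) }

/-- Space-time L^p norm on ℝⁿ × ℝ. -/
def lpNormST (n : ℕ) {E : Type*} [NormedAddCommGroup E] (p : ℝ) (F : Rn n → ℝ → E) : ℝ :=
  (∫ t : ℝ, ∫ x : Rn n, ‖F x t‖ ^ p) ^ (1/p)

/-- Space-time L^p norm on ℝⁿ × [0,δ]. -/
def lpNormSTt (n : ℕ) {E : Type*} [NormedAddCommGroup E] (p δ : ℝ) (F : Rn n → ℝ → E) : ℝ :=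
  (∫ t in Icc (0:ℝ) δ, ∫ x : Rn n, ‖F x t‖ ^ p) ^ (1/p)

open scoped ENNReal

/-- The dispersive weight `⟨x⟩^{-2b}` as an extended nonnegative real. -/
def dispWeight (b x : ℝ) : ℝ≥0∞ := ENNReal.ofReal (japR x ^ (-(2 * b)))

lemma japR_pos (x : ℝ) : 0 < japR x := Real.sqrt_pos.mpr (by positivity)

lemma continuous_japR : Continuous japR := by
  unfold japR; fun_prop

lemma japR_neg (x : ℝ) : japR (-x) = japR x := by simp [japR]

lemma japR_le_two_mul {x y : ℝ} (h : |y| ≤ 2 * |x|) : japR y ≤ 2 * japR x := by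
  unfold japR
  rw [show (2 : ℝ) * √(1 + x ^ 2) = √(4 * (1 + x ^ 2)) by
    rw [Real.sqrt_mul (by norm_num), show (4 : ℝ) = 2 ^ 2 by norm_num, Real.sqrt_sq (by norm_num)]]
  apply Real.sqrt_le_sqrt
  have := mul_self_le_mul_self (abs_nonneg y) h
  rw [abs_mul_abs_self] at this
  nlinarith [abs_mul_abs_self x]

lemma continuous_japR_rpow (r : ℝ) : Continuous fun x => japR x ^ r :=
  continuous_japR.rpow_const fun x => Or.inl (japR_pos x).ne'

@[fun_prop]
lemma measurable_dispWeight (b : ℝ) : Measurable (dispWeight b) :=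
  (continuous_japR_rpow _).measurable.ennreal_ofReal

lemma dispWeight_neg (b x : ℝ) : dispWeight b (-x) = dispWeight b x := by
  simp [dispWeight, japR_neg]

lemma dispWeight_le_of_abs_le {b : ℝ} (hb : 0 ≤ b) {x y : ℝ} (h : |y| ≤ 2 * |x|) :
    dispWeight b x ≤ ENNReal.ofReal (2 ^ (2 * b)) * dispWeight b y := by
  unfold dispWeight
  rw [← ENNReal.ofReal_mul (by positivity)]
  apply ENNReal.ofReal_le_ofReal
  rw [Real.rpow_neg (japR_pos x).le, Real.rpow_neg (japR_pos y).le, ← div_eq_mul_inv,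
    le_div_iff₀ (Real.rpow_pos_of_pos (japR_pos y) _), inv_mul_le_iff₀
    (Real.rpow_pos_of_pos (japR_pos x) _), mul_comm (japR x ^ _),
    ← Real.mul_rpow (by norm_num) (japR_pos x).le]
  exact Real.rpow_le_rpow (japR_pos y).le (japR_le_two_mul h) (by positivity)

lemma dispWeight_mul_le {b : ℝ} (hb : 0 ≤ b) (x y : ℝ) :
    dispWeight b x * dispWeight b y ≤
      ENNReal.ofReal (2 ^ (2 * b)) * dispWeight b (x + y) * (dispWeight b x + dispWeight b y) := by
  rcases le_total |y| |x| with h | h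
  · have := dispWeight_le_of_abs_le hb (x := x) (y := x + y) (by linarith [abs_add_le x y])
    calc dispWeight b x * dispWeight b y
        ≤ ENNReal.ofReal (2 ^ (2 * b)) * dispWeight b (x + y) * dispWeight b y := by gcongr
      _ ≤ _ := by gcongr; exact le_add_self
  · have := dispWeight_le_of_abs_le hb (x := y) (y := x + y) (by linarith [abs_add_le x y])
    calc dispWeight b x * dispWeight b y = dispWeight b y * dispWeight b x := mul_comm _ _
      _ ≤ ENNReal.ofReal (2 ^ (2 * b)) * dispWeight b (x + y) * dispWeight b x := by gcongr
      _ ≤ _ := by gcongr; exact le_self_add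

/-- The total mass of the dispersive weight. -/
def dispMass (b : ℝ) : ℝ≥0∞ := ∫⁻ x, dispWeight b x

lemma dispMass_lt_top {b : ℝ} (hb : 1 / 2 < b) : dispMass b < ∞ := by
  have h := integrable_rpow_neg_one_add_norm_sq (E := ℝ) (μ := volume) (r := 2 * b)
    (by simp; linarith)
  have h2 : (fun x : ℝ => japR x ^ (-(2 * b))) = fun x => (1 + ‖x‖ ^ 2) ^ (-(2 * b) / 2) := by
    ext x
    rw [japR, Real.sqrt_eq_rpow, ← Real.rpow_mul (by positivity)]
    congr 1
    · simp
    · ring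
  rw [← h2] at h
  exact h.lintegral_lt_top

lemma lintegral_dispWeight_sub (b a : ℝ) : ∫⁻ x, dispWeight b (x - a) = dispMass b :=
  lintegral_sub_right_eq_self _ a

lemma lintegral_dispWeight_sub' (b a : ℝ) : ∫⁻ x, dispWeight b (a - x) = dispMass b := by
  rw [← lintegral_dispWeight_sub b a]
  congr with x
  rw [← dispWeight_neg, neg_sub]

lemma lintegral_dispWeight_mul_le {b : ℝ} (hb : 0 ≤ b) (α β : ℝ) :
    ∫⁻ τ, dispWeight b (τ - α) * dispWeight b (β - τ) ≤
      ENNReal.ofReal (2 ^ (2 * b)) * (2 * dispMass b) * dispWeight b (β - α) := by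
  calc ∫⁻ τ, dispWeight b (τ - α) * dispWeight b (β - τ)
      ≤ ∫⁻ τ, ENNReal.ofReal (2 ^ (2 * b)) * dispWeight b (β - α) *
          (dispWeight b (τ - α) + dispWeight b (β - τ)) := by
        apply lintegral_mono
        intro τ
        have := dispWeight_mul_le hb (τ - α) (β - τ)
        rwa [show τ - α + (β - τ) = β - α by ring] at this
    _ = ENNReal.ofReal (2 ^ (2 * b)) * dispWeight b (β - α) * (dispMass b + dispMass b) := by
        rw [lintegral_const_mul _ (by fun_prop), lintegral_add_left (by fun_prop),
          lintegral_dispWeight_sub, lintegral_dispWeight_sub']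
    _ = _ := by ring

lemma setLIntegral_Ici_mul_comp_two_mul_sq_le {L : ℝ} (hL : 0 ≤ L) (g : ℝ → ℝ≥0∞) :
    ∫⁻ u in Ici L, ENNReal.ofReal |4 * u| * g (2 * u ^ 2) ≤ ∫⁻ v, g v := by
  rw [← lintegral_image_eq_lintegral_abs_deriv_mul (f := fun u => 2 * u ^ 2) measurableSet_Ici]
  · exact setLIntegral_le_lintegral _ _
  · intro x _
    have := ((hasDerivAt_pow 2 x).const_mul 2).hasDerivWithinAt (s := Ici L)
    refine this.congr_deriv ?_
    norm_num
    ring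
  · intro x hx y hy hxy
    simp only [mem_Ici] at hx hy hxy
    exact (sq_eq_sq₀ (hL.trans hx) (hL.trans hy)).mp (by linarith)

lemma setLIntegral_Ici_comp_two_mul_sq_le {L : ℝ} (hL : 0 < L) (g : ℝ → ℝ≥0∞) :
    ∫⁻ u in Ici L, g (2 * u ^ 2) ≤ (ENNReal.ofReal L)⁻¹ * ∫⁻ v, g v := by
  rw [← ENNReal.div_eq_inv_mul, ENNReal.le_div_iff_mul_le (by simp [hL]) (by simp), mul_comm]
  refine le_trans ?_ (setLIntegral_Ici_mul_comp_two_mul_sq_le hL.le g)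
  rw [← lintegral_const_mul' _ _ (by simp)]
  refine setLIntegral_mono' measurableSet_Ici fun u hu => ?_
  gcongr
  simp only [mem_Ici] at hu
  rw [abs_of_nonneg (by linarith)]
  linarith

lemma lintegral_indicator_comp_two_mul_sq_le {L : ℝ} (hL : 0 < L) (g : ℝ → ℝ≥0∞) (c : ℝ) :
    ∫⁻ x, {x | L ≤ |x - c|}.indicator (fun x => g (2 * (x - c) ^ 2)) x ≤
      2 * (ENNReal.ofReal L)⁻¹ * ∫⁻ v, g v := by
  have h1 := lintegral_sub_right_eq_self (μ := volume)
    (fun u => {u : ℝ | L ≤ |u|}.indicator (fun u => g (2 * u ^ 2)) u) c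
  have h2 : (fun x => {x | L ≤ |x - c|}.indicator (fun x => g (2 * (x - c) ^ 2)) x) =
      fun x => {u : ℝ | L ≤ |u|}.indicator (fun u => g (2 * u ^ 2)) (x - c) := rfl
  rw [h2, h1]
  have hm : MeasurableSet {u : ℝ | L ≤ |u|} :=
    measurableSet_le measurable_const measurable_abs
  rw [lintegral_indicator hm]
  have hsub : {u : ℝ | L ≤ |u|} = Ici L ∪ Iic (-L) := by
    ext u; simp [le_abs, le_neg]
  rw [hsub]
  refine (lintegral_union_le _ _ _).trans ?_
  have hneg : ∫⁻ u in Iic (-L), g (2 * u ^ 2) = ∫⁻ u in Ici L, g (2 * u ^ 2) := by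
    rw [← lintegral_indicator measurableSet_Iic, ← lintegral_indicator measurableSet_Ici,
      ← lintegral_neg_eq_self]
    congr with u
    simp only [indicator, mem_Iic, neg_le_neg_iff, mem_Ici, neg_sq]
  rw [hneg, ← two_mul, mul_assoc]
  gcongr
  exact setLIntegral_Ici_comp_two_mul_sq_le hL g

lemma lintegral_dispWeight_sub_two_mul_norm_sq_le {b : ℝ} (hb : 1 / 2 < b) (a : ℝ) :
    ∫⁻ η : Rn 2, dispWeight b (a - 2 * ‖η‖ ^ 2) ≤
      ENNReal.ofReal (2 * (volume : Measure (Rn 2)).real (Metric.ball 0 1)) * dispMass b := by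
  set f : ℝ → ℝ := fun y => japR (a - 2 * y ^ 2) ^ (-(2 * b)) with hf
  have hfc : Continuous f := (continuous_japR_rpow _).comp (by fun_prop)
  have hf0 : ∀ y, 0 ≤ f y := fun y => Real.rpow_nonneg (japR_pos _).le _
  have hdim : Module.finrank ℝ (Rn 2) - 1 = 1 := by simp
  have hJ : ∫⁻ y in Ioi (0 : ℝ), ENNReal.ofReal (y * f y) ≤ dispMass b := by
    calc ∫⁻ y in Ioi (0 : ℝ), ENNReal.ofReal (y * f y)
        ≤ ∫⁻ y in Ici (0 : ℝ), ENNReal.ofReal |4 * y| * dispWeight b (a - 2 * y ^ 2) := by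
          refine (setLIntegral_mono' measurableSet_Ioi fun y hy => ?_).trans
            (lintegral_mono_set Ioi_subset_Ici_self)
          rw [ENNReal.ofReal_mul (le_of_lt hy)]
          unfold dispWeight
          gcongr
          simp only [mem_Ioi] at hy
          rw [abs_of_pos (by linarith)]
          linarith
      _ ≤ _ := (setLIntegral_Ici_mul_comp_two_mul_sq_le le_rfl fun v => dispWeight b (a - v)).trans
          (lintegral_dispWeight_sub' b a).le
  have hi : IntegrableOn (fun y => y * f y) (Ioi (0 : ℝ)) := by
    refine ⟨(by fun_prop : Continuous fun y => y * f y).aestronglyMeasurable, ?_⟩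
    rw [hasFiniteIntegral_iff_ofReal]
    · exact hJ.trans_lt (dispMass_lt_top hb)
    · filter_upwards [ae_restrict_mem measurableSet_Ioi] with y hy
      exact mul_nonneg (le_of_lt hy) (hf0 y)
  have hnn : 0 ≤ᵐ[volume.restrict (Ioi (0 : ℝ))] fun y => y * f y := by
    filter_upwards [ae_restrict_mem measurableSet_Ioi] with y hy
    exact mul_nonneg (le_of_lt hy) (hf0 y)
  have hi2 : Integrable (fun η : Rn 2 => f ‖η‖) := by
    rw [integrable_fun_norm_addHaar volume, hdim]
    simpa using hi
  have heq := integral_fun_norm_addHaar (volume : Measure (Rn 2)) f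
  rw [hdim] at heq
  simp only [pow_one, smul_eq_mul, finrank_euclideanSpace, Fintype.card_fin, nsmul_eq_mul] at heq
  change ∫⁻ η : Rn 2, ENNReal.ofReal (f ‖η‖) ≤ _
  rw [← ofReal_integral_eq_lintegral_ofReal hi2 (Filter.Eventually.of_forall fun η => hf0 _), heq,
    ← mul_assoc, ENNReal.ofReal_mul (by positivity), ofReal_integral_eq_lintegral_ofReal hi hnn]
  push_cast
  gcongr

lemma lintegral_Rn_two (j : Fin 2) {H : ℝ × ℝ → ℝ≥0∞} (hH : Measurable H) :
    ∫⁻ ξ : Rn 2, H (ξ j, ξ (1 - j)) = ∫⁻ y, ∫⁻ x, H (x, y) := by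
  have key : ∀ {H : ℝ × ℝ → ℝ≥0∞}, Measurable H →
      ∫⁻ ξ : Rn 2, H (ξ 0, ξ 1) = ∫⁻ p, H p := fun {H} hH =>
    ((volume_preserving_finTwoArrow ℝ).comp
      (PiLp.volume_preserving_ofLp (Fin 2))).lintegral_comp hH
  fin_cases j
  · refine (key hH).trans ?_
    rw [Measure.volume_eq_prod, lintegral_prod_symm _ hH.aemeasurable]
  · refine (key (H := fun p => H p.swap) (hH.comp measurable_swap)).trans ?_
    exact lintegral_prod (μ := volume) (ν := volume) _ (hH.comp measurable_swap).aemeasurable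

lemma norm_sq_add_norm_sub_sq (ξ η : Rn 2) (j : Fin 2) :
    ‖η‖ ^ 2 + ‖ξ - η‖ ^ 2 = 2 * (η j - ξ j / 2) ^ 2 +
      (2 * (η (1 - j) - ξ (1 - j) / 2) ^ 2 + ξ j ^ 2 / 2 + ξ (1 - j) ^ 2 / 2) := by
  simp only [EuclideanSpace.norm_sq_eq, Fin.sum_univ_two, Real.norm_eq_abs, sq_abs,
    PiLp.sub_apply]
  fin_cases j <;> simp <;> ring

lemma norm_sq_add_norm_sub_sq' {V : Type*} [NormedAddCommGroup V] [InnerProductSpace ℝ V]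
    (ξ η : V) :
    ‖η‖ ^ 2 + ‖ξ - η‖ ^ 2 = 2 * ‖η - (1 / 2 : ℝ) • ξ‖ ^ 2 + ‖ξ‖ ^ 2 / 2 := by
  rw [norm_sub_sq_real, norm_sub_sq_real, norm_smul, real_inner_smul_right, real_inner_comm]
  norm_num
  ring

lemma exists_coord_ge (ξ : Rn 2) : ∃ j : Fin 2, ‖ξ‖ / 2 ≤ |ξ j| := by
  by_contra! h
  have h0 := h 0
  have h1 := h 1
  have : ‖ξ‖ ^ 2 = ξ 0 ^ 2 + ξ 1 ^ 2 := by
    simp [EuclideanSpace.norm_sq_eq]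
  nlinarith [sq_abs (ξ 0), sq_abs (ξ 1), abs_nonneg (ξ 0), abs_nonneg (ξ 1), norm_nonneg ξ]

lemma abs_coord_le_norm (ξ : Rn 2) (j : Fin 2) : |ξ j| ≤ ‖ξ‖ := by
  simpa using PiLp.norm_apply_le ξ j

/-- Transversality region: low frequency `η`, high frequency `ξ - η`. -/
def lowHighSet (M₁ M₂ : ℝ) (ξ : Rn 2) : Set (Rn 2) := {η | ‖η‖ ≤ 2 * M₁ ∧ M₂ ≤ jap (ξ - η)}

lemma continuous_jap : Continuous (jap : Rn 2 → ℝ) := by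
  unfold jap; fun_prop

lemma measurableSet_lowHighSet (M₁ M₂ : ℝ) (ξ : Rn 2) : MeasurableSet (lowHighSet M₁ M₂ ξ) :=
  (measurableSet_le (f := fun η : Rn 2 => ‖η‖) (g := fun _ => 2 * M₁) (by fun_prop)
    (by fun_prop)).inter
    (measurableSet_le (f := fun _ => M₂) (g := fun η : Rn 2 => jap (ξ - η)) (by fun_prop)
      (continuous_jap.comp (by fun_prop)).measurable)

lemma half_le_norm_of_le_jap {M : ℝ} (hM : 2 ≤ M) {ξ : Rn 2} (h : M ≤ jap ξ) : M / 2 ≤ ‖ξ‖ := by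
  have h2 : M ^ 2 ≤ 1 + ‖ξ‖ ^ 2 := by
    have := (Real.le_sqrt (by linarith) (by positivity)).mp h
    exact this
  by_contra! hc
  nlinarith [norm_nonneg ξ]

lemma lintegral_lowHigh_separated_le {b M₁ M₂ : ℝ} (hM₁ : 1 ≤ M₁) (hM : 32 * M₁ ≤ M₂)
    (ξ : Rn 2) (τ : ℝ) :
    ∫⁻ η, (lowHighSet M₁ M₂ ξ).indicator
        (fun η => dispWeight b (τ - (‖η‖ ^ 2 + ‖ξ - η‖ ^ 2))) η ≤
      ENNReal.ofReal (512 / 3) * dispMass b * ENNReal.ofReal (M₁ / M₂) := by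
  rcases (lowHighSet M₁ M₂ ξ).eq_empty_or_nonempty with he | ⟨η₀, hη₀, hη₀'⟩
  · simp [he]
  have hξ : 7 / 16 * M₂ ≤ ‖ξ‖ := by
    have h1 := half_le_norm_of_le_jap (by linarith) hη₀'
    have h2 := norm_sub_le ξ η₀
    linarith
  obtain ⟨j, hj⟩ := exists_coord_ge ξ
  set L : ℝ := 3 / 64 * M₂ with hL
  have hL0 : 0 < L := by rw [hL]; linarith
  set c : ℝ → ℝ := fun y => 2 * (y - ξ (1 - j) / 2) ^ 2 + ξ j ^ 2 / 2 + ξ (1 - j) ^ 2 / 2 with hc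
  set H : ℝ × ℝ → ℝ≥0∞ := ({p : ℝ × ℝ | |p.2| ≤ 2 * M₁} ∩
    {p : ℝ × ℝ | L ≤ |p.1 - ξ j / 2|}).indicator
    fun p => dispWeight b (τ - c p.2 - 2 * (p.1 - ξ j / 2) ^ 2) with hH
  have hHm : Measurable H := by
    refine Measurable.indicator ?_ ?_
    · exact (measurable_dispWeight b).comp (by fun_prop)
    · exact (measurableSet_le (by fun_prop) (by fun_prop)).inter
        (measurableSet_le (by fun_prop) (by fun_prop))
  calc ∫⁻ η, (lowHighSet M₁ M₂ ξ).indicator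
        (fun η => dispWeight b (τ - (‖η‖ ^ 2 + ‖ξ - η‖ ^ 2))) η
      ≤ ∫⁻ η : Rn 2, H (η j, η (1 - j)) := by
        refine lintegral_mono fun η => ?_
        by_cases hη : η ∈ lowHighSet M₁ M₂ ξ
        swap
        · simp [indicator_of_notMem hη]
        rw [indicator_of_mem hη]
        obtain ⟨hη1, hη2⟩ := hη
        have hj1 := abs_coord_le_norm η j
        have hj2 := abs_coord_le_norm η (1 - j)
        rw [hH, indicator_of_mem, norm_sq_add_norm_sub_sq ξ η j]
        · apply le_of_eq
          congr 1
          simp only [hc]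
          ring
        · refine ⟨hj2.trans hη1, ?_⟩
          have : |ξ j / 2| - |η j| ≤ |η j - ξ j / 2| := by
            rw [abs_sub_comm]; exact abs_sub_abs_le_abs_sub _ _
          rw [abs_div, abs_two] at this
          simp only [mem_ofPred_eq, hL]
          linarith
    _ = ∫⁻ y, ∫⁻ x, H (x, y) := lintegral_Rn_two j hHm
    _ ≤ ∫⁻ y, (Icc (-(2 * M₁)) (2 * M₁)).indicator
          (fun _ => 2 * (ENNReal.ofReal L)⁻¹ * dispMass b) y := by
        refine lintegral_mono fun y => ?_
        by_cases hy : |y| ≤ 2 * M₁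
        · rw [indicator_of_mem (by rwa [mem_Icc, ← abs_le])]
          have := lintegral_indicator_comp_two_mul_sq_le hL0
            (fun v => dispWeight b (τ - c y - v)) (ξ j / 2)
          rw [lintegral_dispWeight_sub'] at this
          refine le_trans (lintegral_mono fun x => ?_) this
          rw [hH]
          simp only [indicator, mem_inter_iff, mem_ofPred_eq, hy, true_and, le_refl]
        · have : ∀ x, H (x, y) = 0 := fun x => by
            rw [hH, indicator_of_notMem]
            simp [hy]
          simp [this]
    _ = 2 * (ENNReal.ofReal L)⁻¹ * dispMass b * ENNReal.ofReal (4 * M₁) := by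
        rw [lintegral_indicator measurableSet_Icc, setLIntegral_const, Real.volume_Icc]
        congr 2
        ring
    _ = _ := by
        have : (2 : ℝ≥0∞) * (ENNReal.ofReal L)⁻¹ * ENNReal.ofReal (4 * M₁) =
            ENNReal.ofReal (512 / 3) * ENNReal.ofReal (M₁ / M₂) := by
          rw [← ENNReal.ofReal_inv_of_pos hL0, show (2 : ℝ≥0∞) = ENNReal.ofReal 2 by simp,
            ← ENNReal.ofReal_mul (by norm_num), ← ENNReal.ofReal_mul (by positivity),
            ← ENNReal.ofReal_mul (by norm_num)]
          congr 1
          have : M₂ ≠ 0 := by linarith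
          rw [hL]
          field_simp
          norm_num
        rw [mul_right_comm, this, mul_right_comm]

lemma lintegral_dispWeight_sum_sq_le {b : ℝ} (hb : 1 / 2 < b) (ξ : Rn 2) (τ : ℝ) :
    ∫⁻ η, dispWeight b (τ - (‖η‖ ^ 2 + ‖ξ - η‖ ^ 2)) ≤
      ENNReal.ofReal (2 * (volume : Measure (Rn 2)).real (Metric.ball 0 1)) * dispMass b := by
  refine le_trans (le_of_eq ?_)
    (lintegral_dispWeight_sub_two_mul_norm_sq_le hb (τ - ‖ξ‖ ^ 2 / 2))
  rw [← lintegral_sub_right_eq_self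
    (fun η : Rn 2 => dispWeight b (τ - ‖ξ‖ ^ 2 / 2 - 2 * ‖η‖ ^ 2)) ((1 / 2 : ℝ) • ξ)]
  congr with η
  rw [norm_sq_add_norm_sub_sq']
  congr 1
  ring

lemma exists_lowHigh_bound {b : ℝ} (hb : 1 / 2 < b) :
    ∃ C : ℝ, 0 < C ∧ ∀ M₁ M₂ : ℝ, 1 ≤ M₁ → 1 ≤ M₂ → ∀ (ξ : Rn 2) (τ : ℝ),
      ∫⁻ η, (lowHighSet M₁ M₂ ξ).indicator
        (fun η => dispWeight b (τ - (‖η‖ ^ 2 + ‖ξ - η‖ ^ 2))) η ≤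
          ENNReal.ofReal (C * (M₁ / M₂)) := by
  set v : ℝ := 2 * (volume : Measure (Rn 2)).real (Metric.ball 0 1) with hv
  have hv0 : 0 ≤ v := by positivity
  set m : ℝ := (dispMass b).toReal with hm
  have hmm : dispMass b = ENNReal.ofReal m :=
    (ENNReal.ofReal_toReal (dispMass_lt_top hb).ne).symm
  have hm0 : 0 ≤ m := ENNReal.toReal_nonneg
  refine ⟨512 / 3 * m + 32 * (v * m) + 1, by positivity, fun M₁ M₂ h1 h2 ξ τ => ?_⟩
  have hr : 0 < M₁ / M₂ := by positivity
  rcases le_total (32 * M₁) M₂ with h | h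
  · refine (lintegral_lowHigh_separated_le h1 h ξ τ).trans ?_
    rw [hmm, ← ENNReal.ofReal_mul (by norm_num), ← ENNReal.ofReal_mul (by positivity)]
    apply ENNReal.ofReal_le_ofReal
    gcongr
    linarith [mul_nonneg hv0 hm0]
  · refine (lintegral_mono fun η => indicator_le_self _ _ η).trans
      ((lintegral_dispWeight_sum_sq_le hb ξ τ).trans ?_)
    rw [← hv, hmm, ← ENNReal.ofReal_mul hv0]
    apply ENNReal.ofReal_le_ofReal
    have : 1 ≤ 32 * (M₁ / M₂) := by
      rw [← mul_div_assoc, le_div_iff₀ (by positivity)]; linarith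
    nlinarith [mul_nonneg hv0 hm0, mul_nonneg hm0 hr.le]

lemma exists_bilinear_kernel_bound {b : ℝ} (hb : 1 / 2 < b) :
    ∃ C : ℝ, 0 < C ∧ ∀ M₁ M₂ : ℝ, 1 ≤ M₁ → 1 ≤ M₂ → ∀ z : Rn 2 × ℝ,
      ∫⁻ p : Rn 2 × ℝ, {p : Rn 2 × ℝ | p.1 ∈ lowHighSet M₁ M₂ z.1}.indicator
        (fun p => dispWeight b (p.2 - ‖p.1‖ ^ 2) *
          dispWeight b ((z - p).2 - ‖(z - p).1‖ ^ 2)) p ≤ ENNReal.ofReal (C * (M₁ / M₂)) := by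
  obtain ⟨C, hC, h⟩ := exists_lowHigh_bound hb
  have hmm : dispMass b = ENNReal.ofReal (dispMass b).toReal :=
    (ENNReal.ofReal_toReal (dispMass_lt_top hb).ne).symm
  set m : ℝ := (dispMass b).toReal with hm
  have hm0 : 0 ≤ m := ENNReal.toReal_nonneg
  refine ⟨2 ^ (2 * b) * (2 * (m + 1)) * C, by positivity, fun M₁ M₂ h1 h2 z => ?_⟩
  have hS : MeasurableSet {p : Rn 2 × ℝ | p.1 ∈ lowHighSet M₁ M₂ z.1} :=
    measurable_fst (measurableSet_lowHighSet M₁ M₂ z.1)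
  rw [Measure.volume_eq_prod, lintegral_prod]
  · calc _ ≤ ∫⁻ η, ENNReal.ofReal (2 ^ (2 * b)) * (2 * dispMass b) *
          (lowHighSet M₁ M₂ z.1).indicator
            (fun η => dispWeight b (z.2 - (‖η‖ ^ 2 + ‖z.1 - η‖ ^ 2))) η := by
          refine lintegral_mono fun η => ?_
          by_cases hη : η ∈ lowHighSet M₁ M₂ z.1
          · have := lintegral_dispWeight_mul_le (b := b) (by linarith) (‖η‖ ^ 2)
              (z.2 - ‖z.1 - η‖ ^ 2)
            simp only [indicator, mem_ofPred_eq, hη, if_true, Prod.snd_sub, Prod.fst_sub]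
            convert this using 3
            · congr 2; ring
            · ring
          · simp [indicator, hη]
      _ ≤ ENNReal.ofReal (2 ^ (2 * b)) * (2 * dispMass b) * ENNReal.ofReal (C * (M₁ / M₂)) := by
          rw [lintegral_const_mul' _ _ (by rw [hmm]; finiteness)]
          gcongr
          exact h M₁ M₂ h1 h2 z.1 z.2
      _ ≤ _ := by
          rw [hmm, show (2 : ℝ≥0∞) = ENNReal.ofReal 2 by simp, ← ENNReal.ofReal_mul (by norm_num),
            ← ENNReal.ofReal_mul (by positivity), ← ENNReal.ofReal_mul (by positivity)]
          apply ENNReal.ofReal_le_ofReal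
          rw [mul_assoc (2 ^ (2 * b) * (2 * (m + 1)))]
          gcongr
          linarith
  · refine (Measurable.indicator ?_ hS).aemeasurable
    exact ((measurable_dispWeight b).comp (by fun_prop)).mul
      ((measurable_dispWeight b).comp (by fun_prop))

section QuadrilinearForm

lemma sq_lintegral_le_of_weight {α : Type*} [MeasurableSpace α] {μ : Measure α}
    {F k : α → ℝ≥0∞} (hF : Measurable F) (hk : Measurable k) (hk' : ∀ x, k x ≠ ∞)
    (h0 : ∀ x, k x = 0 → F x = 0) :
    (∫⁻ x, F x ∂μ) ^ 2 ≤ (∫⁻ x, F x ^ 2 / k x ∂μ) * ∫⁻ x, k x ∂μ := by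
  have hpt : ∀ x, F x = (F x ^ 2 / k x) ^ (1 / 2 : ℝ) * k x ^ (1 / 2 : ℝ) := fun x => by
    rcases eq_or_ne (k x) 0 with h | h
    · simp [h0 x h, h]
    · rw [← ENNReal.mul_rpow_of_nonneg _ _ (by norm_num), ENNReal.div_mul_cancel h (hk' x),
        ← ENNReal.rpow_natCast, ← ENNReal.rpow_mul]
      norm_num
  have hH := ENNReal.lintegral_mul_le_Lp_mul_Lq μ Real.HolderConjugate.two_two
    (f := fun x => (F x ^ 2 / k x) ^ (1 / 2 : ℝ)) (g := fun x => k x ^ (1 / 2 : ℝ))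
    (Measurable.aemeasurable (by fun_prop)) (Measurable.aemeasurable (by fun_prop))
  simp only [Pi.mul_apply, ← hpt, ← ENNReal.rpow_mul] at hH
  norm_num at hH
  calc (∫⁻ x, F x ∂μ) ^ 2
      ≤ ((∫⁻ x, F x ^ 2 / k x ∂μ) ^ (1 / 2 : ℝ) * (∫⁻ x, k x ∂μ) ^ (1 / 2 : ℝ)) ^ 2 := by gcongr
    _ = _ := by
        rw [mul_pow, ← ENNReal.rpow_natCast, ← ENNReal.rpow_natCast, ← ENNReal.rpow_mul,
          ← ENNReal.rpow_mul]
        norm_num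

variable {G : Type*} [AddCommGroup G] [MeasurableSpace G] [MeasurableAdd₂ G] [MeasurableNeg G]

/-- Convolution of extended nonnegative functions. -/
def econv (μ : Measure G) (f g : G → ℝ≥0∞) (z : G) : ℝ≥0∞ := ∫⁻ p, f p * g (z - p) ∂μ

/-- The quadrilinear form over the hyperplane `x₁ + x₂ + x₃ + x₄ = 0`. -/
def quadForm (μ : Measure G) (g₁ g₂ g₃ g₄ : G → ℝ≥0∞) : ℝ≥0∞ :=
  ∫⁻ x₂, ∫⁻ x₃, ∫⁻ x₄, g₁ (-x₂ - x₃ - x₄) * g₂ x₂ * g₃ x₃ * g₄ x₄ ∂μ ∂μ ∂μ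

variable {μ : Measure G} [SFinite μ]

@[fun_prop]
lemma measurable_econv {f g : G → ℝ≥0∞} (hf : Measurable f) (hg : Measurable g) :
    Measurable (econv μ f g) := by
  unfold econv
  refine Measurable.lintegral_prod_right' (f := fun q : G × G => f q.2 * g (q.1 - q.2)) ?_
  fun_prop

variable [μ.IsAddLeftInvariant]

lemma quadForm_eq {g₁ g₂ g₃ g₄ : G → ℝ≥0∞} (h₁ : Measurable g₁) (h₂ : Measurable g₂)
    (h₃ : Measurable g₃) (h₄ : Measurable g₄) :
    quadForm μ g₁ g₂ g₃ g₄ = ∫⁻ w, econv μ g₃ g₁ (-w) * econv μ g₄ g₂ w ∂μ := by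
  calc quadForm μ g₁ g₂ g₃ g₄
      = ∫⁻ x₂, ∫⁻ x₄, econv μ g₃ g₁ (-(x₂ + x₄)) * (g₂ x₂ * g₄ x₄) ∂μ ∂μ := by
        refine lintegral_congr fun x₂ => ?_
        rw [lintegral_lintegral_swap (Measurable.aemeasurable (by fun_prop))]
        refine lintegral_congr fun x₄ => ?_
        rw [econv, ← lintegral_mul_const _ (by fun_prop)]
        refine lintegral_congr fun x₃ => ?_
        rw [show -x₂ - x₃ - x₄ = -(x₂ + x₄) - x₃ by abel]
        ring
    _ = ∫⁻ x₄, ∫⁻ x₂, econv μ g₃ g₁ (-(x₂ + x₄)) * (g₂ x₂ * g₄ x₄) ∂μ ∂μ :=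
        lintegral_lintegral_swap (Measurable.aemeasurable (by fun_prop))
    _ = ∫⁻ x₄, ∫⁻ w, econv μ g₃ g₁ (-w) * (g₂ (w - x₄) * g₄ x₄) ∂μ ∂μ := by
        refine lintegral_congr fun x₄ => ?_
        rw [← lintegral_sub_right_eq_self _ x₄]
        simp
    _ = ∫⁻ w, ∫⁻ x₄, econv μ g₃ g₁ (-w) * (g₂ (w - x₄) * g₄ x₄) ∂μ ∂μ :=
        lintegral_lintegral_swap (Measurable.aemeasurable (by fun_prop))
    _ = _ := by
        refine lintegral_congr fun w => ?_
        rw [lintegral_const_mul _ (by fun_prop), econv]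
        congr 1
        exact lintegral_congr fun x => mul_comm _ _

lemma sq_quadForm_le [μ.IsNegInvariant] {g₁ g₂ g₃ g₄ : G → ℝ≥0∞} (h₁ : Measurable g₁)
    (h₂ : Measurable g₂) (h₃ : Measurable g₃) (h₄ : Measurable g₄) :
    quadForm μ g₁ g₂ g₃ g₄ ^ 2 ≤
      (∫⁻ z, econv μ g₃ g₁ z ^ 2 ∂μ) * ∫⁻ z, econv μ g₄ g₂ z ^ 2 ∂μ := by
  rw [quadForm_eq h₁ h₂ h₃ h₄]
  have hH := ENNReal.lintegral_mul_le_Lp_mul_Lq μ Real.HolderConjugate.two_two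
    (f := fun w => econv μ g₃ g₁ (-w)) (g := fun w => econv μ g₄ g₂ w)
    (Measurable.aemeasurable (by fun_prop)) (Measurable.aemeasurable (by fun_prop))
  rw [lintegral_neg_eq_self (fun w => econv μ g₃ g₁ w ^ (2 : ℝ))] at hH
  simp only [ENNReal.rpow_ofNat] at hH
  calc _ ≤ ((∫⁻ z, econv μ g₃ g₁ z ^ 2 ∂μ) ^ (1 / 2 : ℝ) *
        (∫⁻ z, econv μ g₄ g₂ z ^ 2 ∂μ) ^ (1 / 2 : ℝ)) ^ 2 := by gcongr; exact hH
    _ = _ := by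
        rw [mul_pow, ← ENNReal.rpow_natCast, ← ENNReal.rpow_natCast, ← ENNReal.rpow_mul,
          ← ENNReal.rpow_mul]
        norm_num

lemma lintegral_sq_econv_le {f g J : G → ℝ≥0∞} (hf : Measurable f) (hg : Measurable g)
    (hJ : Measurable J) (hJ0 : ∀ p, J p ≠ 0) (hJt : ∀ p, J p ≠ ∞) {T : G → Set G}
    (hT : ∀ z, MeasurableSet (T z)) (hfg : ∀ z p, f p ≠ 0 → g (z - p) ≠ 0 → p ∈ T z)
    {K : ℝ≥0∞} (hK : ∀ z, ∫⁻ p, (T z).indicator (fun p => J p * J (z - p)) p ∂μ ≤ K) :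
    ∫⁻ z, econv μ f g z ^ 2 ∂μ ≤
      K * ((∫⁻ p, f p ^ 2 / J p ∂μ) * ∫⁻ p, g p ^ 2 / J p ∂μ) := by
  have hcs : ∀ z, econv μ f g z ^ 2 ≤
      K * ∫⁻ p, (f p ^ 2 / J p) * (g (z - p) ^ 2 / J (z - p)) ∂μ := fun z => by
    have hkm : Measurable fun p => (T z).indicator (fun p => J p * J (z - p)) p :=
      Measurable.indicator (by fun_prop) (hT z)
    refine (sq_lintegral_le_of_weight (F := fun p => f p * g (z - p)) (by fun_prop) hkm
      ?_ ?_).trans ?_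
    · intro p
      by_cases hp : p ∈ T z
      · rw [indicator_of_mem hp]; exact ENNReal.mul_ne_top (hJt _) (hJt _)
      · simp [hp]
    · intro p hp
      by_contra hne
      replace hne := mul_ne_zero_iff.mp hne
      rw [indicator_of_mem (hfg z p hne.1 hne.2)] at hp
      exact mul_ne_zero (hJ0 _) (hJ0 _) hp
    · rw [mul_comm]
      refine mul_le_mul' (hK z) (lintegral_mono fun p => ?_)
      by_cases hp : f p * g (z - p) = 0
      · simp [hp]
      · have hp' := mul_ne_zero_iff.mp hp
        rw [indicator_of_mem (hfg z p hp'.1 hp'.2), mul_pow,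
          ENNReal.div_eq_inv_mul, ENNReal.div_eq_inv_mul, ENNReal.div_eq_inv_mul,
          ENNReal.mul_inv (Or.inl (hJ0 _)) (Or.inl (hJt _))]
        apply le_of_eq
        ring
  calc ∫⁻ z, econv μ f g z ^ 2 ∂μ
      ≤ ∫⁻ z, K * ∫⁻ p, (f p ^ 2 / J p) * (g (z - p) ^ 2 / J (z - p)) ∂μ ∂μ :=
        lintegral_mono hcs
    _ = K * ∫⁻ z, ∫⁻ p, (f p ^ 2 / J p) * (g (z - p) ^ 2 / J (z - p)) ∂μ ∂μ := by
        refine lintegral_const_mul _ ?_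
        refine Measurable.lintegral_prod_right'
          (f := fun q : G × G => (f q.2 ^ 2 / J q.2) * (g (q.1 - q.2) ^ 2 / J (q.1 - q.2))) ?_
        fun_prop
    _ = K * ∫⁻ p, ∫⁻ z, (f p ^ 2 / J p) * (g (z - p) ^ 2 / J (z - p)) ∂μ ∂μ := by
        rw [lintegral_lintegral_swap (Measurable.aemeasurable (by fun_prop))]
    _ = _ := by
        congr 1
        rw [← lintegral_mul_const _ (by fun_prop)]
        refine lintegral_congr fun p => ?_
        rw [lintegral_const_mul _ (by fun_prop),
          lintegral_sub_right_eq_self (fun z => g z ^ 2 / J z) p]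

end QuadrilinearForm

/-- The weight `⟨τ - |ξ|²⟩^{-2b}` on frequency space. -/
def paraWeight (b : ℝ) (p : Rn 2 × ℝ) : ℝ≥0∞ := dispWeight b (p.2 - ‖p.1‖ ^ 2)

@[fun_prop]
lemma measurable_paraWeight (b : ℝ) : Measurable (paraWeight b) :=
  (measurable_dispWeight b).comp (by fun_prop)

lemma paraWeight_ne_zero (b : ℝ) (p : Rn 2 × ℝ) : paraWeight b p ≠ 0 := by
  simp [paraWeight, dispWeight, Real.rpow_pos_of_pos (japR_pos _)]

lemma paraWeight_ne_top (b : ℝ) (p : Rn 2 × ℝ) : paraWeight b p ≠ ∞ := ENNReal.ofReal_ne_top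

/-- The squared `X_{0,b}` norm of a space-time frequency profile. -/
def profileEnergy (b : ℝ) (g : Rn 2 × ℝ → ℝ≥0∞) : ℝ≥0∞ := ∫⁻ p, g p ^ 2 / paraWeight b p

instance : (volume : Measure (Rn 2 × ℝ)).IsAddHaarMeasure :=
  inferInstanceAs ((volume : Measure (Rn 2)).prod (volume : Measure ℝ)).IsAddHaarMeasure

instance : (volume : Measure (Rn 2 × ℝ)).IsAddLeftInvariant := inferInstance

instance : (volume : Measure (Rn 2 × ℝ)).IsNegInvariant := inferInstance

lemma norm_le_jap (ξ : Rn 2) : ‖ξ‖ ≤ jap ξ := by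
  unfold jap
  exact Real.le_sqrt_of_sq_le (by linarith)

lemma exists_lintegral_sq_econv_le {b : ℝ} (hb : 1 / 2 < b) :
    ∃ C : ℝ, 0 < C ∧ ∀ M₁ M₂ : ℝ, 1 ≤ M₁ → 1 ≤ M₂ → ∀ f g : Rn 2 × ℝ → ℝ≥0∞,
      Measurable f → Measurable g → (∀ p, f p ≠ 0 → jap p.1 ≤ 2 * M₁) →
      (∀ p, g p ≠ 0 → M₂ ≤ jap p.1) →
      ∫⁻ z, econv volume f g z ^ 2 ≤
        ENNReal.ofReal (C * (M₁ / M₂)) * (profileEnergy b f * profileEnergy b g) := by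
  obtain ⟨C, hC, h⟩ := exists_bilinear_kernel_bound hb
  refine ⟨C, hC, fun M₁ M₂ h1 h2 f g hf hg hfs hgs => ?_⟩
  have hT : ∀ z : Rn 2 × ℝ, MeasurableSet {p : Rn 2 × ℝ | p.1 ∈ lowHighSet M₁ M₂ z.1} :=
    fun z => measurable_fst (measurableSet_lowHighSet M₁ M₂ z.1)
  have hfg : ∀ z p : Rn 2 × ℝ, f p ≠ 0 → g (z - p) ≠ 0 →
      p ∈ {p : Rn 2 × ℝ | p.1 ∈ lowHighSet M₁ M₂ z.1} :=
    fun z p hp hq => by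
      have h1 := (norm_le_jap _).trans (hfs p hp)
      have h2 := hgs _ hq
      rw [Prod.fst_sub] at h2
      rw [mem_ofPred_eq, lowHighSet, mem_ofPred_eq]
      exact ⟨h1, h2⟩
  have hK : ∀ z : Rn 2 × ℝ, ∫⁻ p, {p : Rn 2 × ℝ | p.1 ∈ lowHighSet M₁ M₂ z.1}.indicator
      (fun p => paraWeight b p * paraWeight b (z - p)) p ≤ ENNReal.ofReal (C * (M₁ / M₂)) :=
    h M₁ M₂ h1 h2
  exact lintegral_sq_econv_le hf hg (measurable_paraWeight b) (paraWeight_ne_zero b)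
    (paraWeight_ne_top b) hT hfg hK

lemma exists_sq_quadForm_le {b : ℝ} (hb : 1 / 2 < b) :
    ∃ C : ℝ, 0 < C ∧ ∀ M₁ M₂ M₃ M₄ : ℝ, 1 ≤ M₁ → 1 ≤ M₂ → 1 ≤ M₃ → 1 ≤ M₄ →
      ∀ g₁ g₂ g₃ g₄ : Rn 2 × ℝ → ℝ≥0∞,
      Measurable g₁ → Measurable g₂ → Measurable g₃ → Measurable g₄ →
      (∀ p, g₁ p ≠ 0 → M₁ ≤ jap p.1) → (∀ p, g₂ p ≠ 0 → M₂ ≤ jap p.1) →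
      (∀ p, g₃ p ≠ 0 → jap p.1 ≤ 2 * M₃) → (∀ p, g₄ p ≠ 0 → jap p.1 ≤ 2 * M₄) →
      quadForm volume g₁ g₂ g₃ g₄ ^ 2 ≤ ENNReal.ofReal (C * ((M₃ / M₁) * (M₄ / M₂))) *
        (profileEnergy b g₁ * profileEnergy b g₂ * profileEnergy b g₃ * profileEnergy b g₄) := by
  obtain ⟨C, hC, h⟩ := exists_lintegral_sq_econv_le hb
  refine ⟨C * C, by positivity, ?_⟩
  intro M₁ M₂ M₃ M₄ h1 h2 h3 h4 g₁ g₂ g₃ g₄ m1 m2 m3 m4 s1 s2 s3 s4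
  refine (sq_quadForm_le m1 m2 m3 m4).trans ?_
  refine (mul_le_mul' (h M₃ M₁ h3 h1 g₃ g₁ m3 m1 s3 s1) (h M₄ M₂ h4 h2 g₄ g₂ m4 m2 s4 s2)).trans
    (le_of_eq ?_)
  rw [show C * C * (M₃ / M₁ * (M₄ / M₂)) = (C * (M₃ / M₁)) * (C * (M₄ / M₂)) by ring,
    ENNReal.ofReal_mul (p := C * (M₃ / M₁)) (by positivity)]
  ring

section SpaceTimeFourier

open scoped SchwartzMap

lemma SchwartzMap.exists_one_add_norm_pow_mul_norm_le {V : Type*} [NormedAddCommGroup V]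
    [NormedSpace ℝ V] (f : 𝓢(V, ℂ)) (k : ℕ) :
    ∃ C : ℝ, 0 < C ∧ ∀ x, (1 + ‖x‖) ^ k * ‖f x‖ ≤ C := by
  refine ⟨|2 ^ k * (Finset.Iic (k, 0)).sup (fun m => SchwartzMap.seminorm ℂ m.1 m.2) f| + 1,
    by positivity, fun x => ?_⟩
  have h := SchwartzMap.one_add_le_sup_seminorm_apply (𝕜 := ℂ) (m := (k, 0)) le_rfl le_rfl f x
  rw [norm_iteratedFDeriv_zero] at h
  exact h.trans ((le_abs_self _).trans (by linarith))

/-- The Fourier transform in the space variable only. -/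
def spaceFourier (φ : 𝓢(Rn 2 × ℝ, ℂ)) (ξ : Rn 2) (t : ℝ) : ℂ := 𝓕 (fun x => φ (x, t)) ξ

/-- The space-time Fourier transform as a function on the product. -/
def freqProfile (φ : 𝓢(Rn 2 × ℝ, ℂ)) (p : Rn 2 × ℝ) : ℂ :=
  stFourier 2 (fun x t => φ (x, t)) p.1 p.2

variable (φ : 𝓢(Rn 2 × ℝ, ℂ))

lemma continuous_spaceFourier : Continuous (fun q : Rn 2 × ℝ => spaceFourier φ q.1 q.2) := by
  obtain ⟨C, -, hC⟩ := φ.exists_one_add_norm_pow_mul_norm_le 3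
  simp only [spaceFourier, Real.fourier_eq]
  refine continuous_of_dominated (bound := fun x : Rn 2 => C * (1 + ‖x‖) ^ (-(3 : ℝ))) ?_ ?_ ?_ ?_
  · intro q
    refine Continuous.aestronglyMeasurable ?_
    fun_prop
  · intro q
    refine Filter.Eventually.of_forall fun x => ?_
    rw [Circle.norm_smul]
    have h1 := hC (x, q.2)
    have h2 : ‖x‖ ≤ ‖(x, q.2)‖ := norm_fst_le (x, q.2)
    rw [Real.rpow_neg (by positivity), ← div_eq_mul_inv, le_div_iff₀ (by positivity)]
    norm_cast
    calc ‖φ (x, q.2)‖ * (1 + ‖x‖) ^ 3 ≤ ‖φ (x, q.2)‖ * (1 + ‖(x, q.2)‖) ^ 3 := by gcongr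
      _ ≤ C := by rw [mul_comm]; exact h1
  · exact (integrable_one_add_norm (by simp; norm_num)).const_mul C
  · refine Filter.Eventually.of_forall fun x => ?_
    fun_prop

lemma integrable_twist (ξ : Rn 2) (τ : ℝ) :
    Integrable (fun q : Rn 2 × ℝ => Complex.exp (Complex.I *
      ((-2 * Real.pi * (⟪q.1, ξ⟫ + q.2 * τ) : ℝ) : ℂ)) • φ (q.1, q.2)) := by
  have hφ := φ.continuous
  refine (φ.integrable (μ := volume)).norm.mono' (Continuous.aestronglyMeasurable (by fun_prop)) ?_
  refine Filter.Eventually.of_forall fun q => ?_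
  rw [norm_smul, mul_comm Complex.I, Complex.norm_exp_ofReal_mul_I, one_mul]

lemma integrable_spaceFourier (ξ : Rn 2) : Integrable (spaceFourier φ ξ) := by
  have h := (integrable_twist φ ξ 0).integral_prod_right
  refine h.congr (Filter.Eventually.of_forall fun t => ?_)
  simp only [spaceFourier, Real.fourier_eq']
  refine integral_congr_ae (Filter.Eventually.of_forall fun x => ?_)
  simp [mul_comm]

lemma fourier_spaceFourier (ξ : Rn 2) (τ : ℝ) :
    𝓕 (spaceFourier φ ξ) τ = freqProfile φ (ξ, τ) := by
  simp only [freqProfile, stFourier]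
  rw [integral_integral_swap (integrable_twist φ ξ τ), Real.fourier_eq']
  refine integral_congr_ae (Filter.Eventually.of_forall fun t => ?_)
  simp only [spaceFourier, Real.fourier_eq']
  rw [← integral_smul]
  refine integral_congr_ae (Filter.Eventually.of_forall fun x => ?_)
  simp only [smul_eq_mul]
  rw [← mul_assoc, ← Complex.exp_add]
  congr 2
  simp
  ring

lemma exists_schwartz_freqProfile : ∃ ψ : 𝓢(WithLp 2 (Rn 2 × ℝ), ℂ),
    ∀ p, freqProfile φ p = ψ (WithLp.toLp 2 p) := by
  set χ : 𝓢(WithLp 2 (Rn 2 × ℝ), ℂ) := SchwartzMap.compCLMOfContinuousLinearEquiv ℂ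
    (WithLp.prodContinuousLinearEquiv 2 ℝ (Rn 2) ℝ) φ with hχ
  refine ⟨𝓕 χ, fun p => ?_⟩
  rw [SchwartzMap.fourier_coe, Real.fourier_eq']
  simp only [freqProfile, stFourier]
  rw [integral_integral (integrable_twist φ p.1 p.2)]
  rw [← (WithLp.volume_preserving_toLp (U := Rn 2) (V := ℝ)).integral_comp
    (MeasurableEquiv.toLp 2 (Rn 2 × ℝ)).measurableEmbedding]
  refine integral_congr_ae (Filter.Eventually.of_forall fun q => ?_)
  simp only [WithLp.prod_inner_apply]
  rw [mul_comm Complex.I]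
  congr 3
  simp [mul_comm]

lemma continuous_freqProfile : Continuous (freqProfile φ) := by
  obtain ⟨ψ, hψ⟩ := exists_schwartz_freqProfile φ
  rw [funext hψ]
  exact ψ.continuous.comp (WithLp.prod_continuous_toLp 2 _ _)

lemma exists_freqProfile_decay (k : ℕ) :
    ∃ C : ℝ, 0 < C ∧ ∀ p, (1 + ‖p‖) ^ k * ‖freqProfile φ p‖ ≤ C := by
  obtain ⟨ψ, hψ⟩ := exists_schwartz_freqProfile φ
  obtain ⟨C, hC0, hC⟩ := ψ.exists_one_add_norm_pow_mul_norm_le k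
  refine ⟨C, hC0, fun p => ?_⟩
  have h2 : ‖p‖ ≤ ‖WithLp.toLp 2 p‖ := by
    rw [WithLp.prod_norm_eq_of_L2, Prod.norm_def]
    refine max_le (Real.le_sqrt_of_sq_le ?_) (Real.le_sqrt_of_sq_le ?_)
    · simp; positivity
    · simp
  rw [hψ]
  refine le_trans ?_ (hC (WithLp.toLp 2 p))
  gcongr

lemma integrable_freqProfile_snd (ξ : Rn 2) : Integrable (fun τ => freqProfile φ (ξ, τ)) := by
  obtain ⟨C, -, hC⟩ := exists_freqProfile_decay φ 2
  have hb : Integrable (fun τ : ℝ => C * (1 + ‖τ‖) ^ (-(2 : ℝ))) :=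
    (integrable_one_add_norm (by simp)).const_mul C
  refine hb.mono' (Continuous.aestronglyMeasurable
    ((continuous_freqProfile φ).comp (by fun_prop))) (Filter.Eventually.of_forall fun τ => ?_)
  have h1 := hC (ξ, τ)
  have h2 : ‖τ‖ ≤ ‖(ξ, τ)‖ := norm_snd_le (ξ, τ)
  rw [Real.rpow_neg (by positivity), ← div_eq_mul_inv, le_div_iff₀ (by positivity)]
  norm_cast
  calc ‖freqProfile φ (ξ, τ)‖ * (1 + ‖τ‖) ^ 2
      ≤ ‖freqProfile φ (ξ, τ)‖ * (1 + ‖(ξ, τ)‖) ^ 2 := by gcongr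
    _ ≤ C := by rw [mul_comm]; exact h1

lemma freqProfile_eq_zero {ξ : Rn 2} (h : ∀ t, spaceFourier φ ξ t = 0) (τ : ℝ) :
    freqProfile φ (ξ, τ) = 0 := by
  rw [← fourier_spaceFourier, Real.fourier_eq]
  simp [h]

end SpaceTimeFourier

lemma enorm_fourier_mul_le {h g : ℝ → ℂ} (hh : Integrable h) (hg : Integrable g)
    (hgc : Continuous g) (hg' : Integrable (𝓕 g)) (η : ℝ) :
    ‖𝓕 (fun t => h t * g t) η‖ₑ ≤ ∫⁻ a, ‖𝓕 h (η - a)‖ₑ * ‖𝓕 g a‖ₑ := by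
  have hinv : ∀ t, g t = ∫ a : ℝ, Complex.exp (2 * Real.pi * (a * t) * Complex.I) * 𝓕 g a :=
    fun t => by
      conv_lhs => rw [← hgc.fourierInv_fourier_eq hg hg']
      rw [Real.fourierInv_eq']
      simp [mul_comm]
  have hE : ∀ r : ℝ, ‖Complex.exp (r * Complex.I)‖ = 1 := Complex.norm_exp_ofReal_mul_I
  have hi : Integrable (fun q : ℝ × ℝ => (Complex.exp (((2 * Real.pi * (q.2 * q.1) -
      2 * Real.pi * (q.1 * η) : ℝ) : ℂ) * Complex.I)) * (h q.1 * 𝓕 g q.2)) := by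
    refine (hh.mul_prod hg').bdd_mul (c := 1) (Continuous.aestronglyMeasurable (by fun_prop)) ?_
    exact Filter.Eventually.of_forall fun q => (hE _).le
  have key : 𝓕 (fun t => h t * g t) η = ∫ a, 𝓕 h (η - a) * 𝓕 g a := by
    calc 𝓕 (fun t => h t * g t) η
        = ∫ t, ∫ a, (Complex.exp (((2 * Real.pi * (a * t) -
          2 * Real.pi * (t * η) : ℝ) : ℂ) * Complex.I)) * (h t * 𝓕 g a) := by
          rw [Real.fourier_eq']
          refine integral_congr_ae (Filter.Eventually.of_forall fun t => ?_)
          simp only [smul_eq_mul]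
          rw [hinv t, ← integral_const_mul, ← integral_const_mul]
          refine integral_congr_ae (Filter.Eventually.of_forall fun a => ?_)
          simp only
          rw [show ((2 * Real.pi * (a * t) - 2 * Real.pi * (t * η) : ℝ) : ℂ) * Complex.I =
            ((-2 * Real.pi * inner ℝ t η : ℝ) : ℂ) * Complex.I +
              2 * Real.pi * (a * t) * Complex.I by simp; ring, Complex.exp_add]
          ring
      _ = ∫ a, ∫ t, (Complex.exp (((2 * Real.pi * (a * t) -
          2 * Real.pi * (t * η) : ℝ) : ℂ) * Complex.I)) * (h t * 𝓕 g a) :=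
          integral_integral_swap hi
      _ = _ := by
          refine integral_congr_ae (Filter.Eventually.of_forall fun a => ?_)
          simp only
          rw [Real.fourier_eq' h, ← integral_mul_const]
          refine integral_congr_ae (Filter.Eventually.of_forall fun t => ?_)
          simp only [smul_eq_mul]
          rw [← mul_assoc]
          congr 4
          simp
          ring
  rw [key]
  refine (enorm_integral_le_lintegral_enorm _).trans (le_of_eq ?_)
  simp only [enorm_mul]

section FourierAlgebra

/-- Continuous integrable functions on the line with integrable Fourier transform. -/
structure InFourierAlgebra (g : ℝ → ℂ) : Prop where
  continuous : Continuous g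
  integrable : Integrable g
  integrable_fourier : Integrable (𝓕 g)

lemma InFourierAlgebra.bounded {g : ℝ → ℂ} (hg : InFourierAlgebra g) (t : ℝ) :
    ‖g t‖ ≤ ∫ a, ‖𝓕 g a‖ := by
  conv_lhs => rw [← hg.continuous.fourierInv_fourier_eq hg.integrable hg.integrable_fourier]
  rw [Real.fourierInv_eq']
  refine (norm_integral_le_integral_norm _).trans (le_of_eq ?_)
  simp only [norm_smul, Complex.norm_exp_ofReal_mul_I, one_mul]

lemma InFourierAlgebra.integrable_mul {g h : ℝ → ℂ} (hg : InFourierAlgebra g)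
    (hh : Integrable h) : Integrable (fun t => h t * g t) :=
  hh.mul_bdd hg.continuous.aestronglyMeasurable (Filter.Eventually.of_forall hg.bounded)

lemma enorm_integral_mul_four_le {f₁ f₂ f₃ f₄ : ℝ → ℂ} (h₁ : Integrable f₁)
    (h₂ : InFourierAlgebra f₂) (h₃ : InFourierAlgebra f₃) (h₄ : InFourierAlgebra f₄) :
    ‖∫ t, f₁ t * f₂ t * f₃ t * f₄ t‖ₑ ≤ ∫⁻ τ₂, ∫⁻ τ₃, ∫⁻ τ₄,
      ‖𝓕 f₁ (-τ₂ - τ₃ - τ₄)‖ₑ * ‖𝓕 f₂ τ₂‖ₑ * ‖𝓕 f₃ τ₃‖ₑ * ‖𝓕 f₄ τ₄‖ₑ := by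
  have e : ∫ t, f₁ t * f₂ t * f₃ t * f₄ t = 𝓕 (fun t => f₁ t * f₄ t * f₃ t * f₂ t) 0 := by
    rw [Real.fourier_eq']
    refine integral_congr_ae (Filter.Eventually.of_forall fun t => ?_)
    simp
    ring
  have i4 := h₄.integrable_mul h₁
  have i3 := h₃.integrable_mul i4
  rw [e]
  refine (enorm_fourier_mul_le i3 h₂.integrable h₂.continuous h₂.integrable_fourier 0).trans ?_
  refine lintegral_mono fun τ₂ => ?_
  have b3 := enorm_fourier_mul_le i4 h₃.integrable h₃.continuous h₃.integrable_fourier (0 - τ₂)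
  refine (mul_le_mul' b3 le_rfl).trans ?_
  rw [← lintegral_mul_const' _ _ enorm_ne_top]
  refine lintegral_mono fun τ₃ => ?_
  have b4 := enorm_fourier_mul_le h₁ h₄.integrable h₄.continuous h₄.integrable_fourier
    (0 - τ₂ - τ₃)
  refine (mul_le_mul' (mul_le_mul' b4 le_rfl) le_rfl).trans ?_
  rw [← lintegral_mul_const' _ _ enorm_ne_top, ← lintegral_mul_const' _ _ enorm_ne_top]
  refine lintegral_mono fun τ₄ => le_of_eq ?_
  rw [zero_sub]
  ring

end FourierAlgebra

lemma inFourierAlgebra_spaceFourier (φ : SchwartzMap (Rn 2 × ℝ) ℂ) (ξ : Rn 2) :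
    InFourierAlgebra (spaceFourier φ ξ) := by
  have hc : Continuous (fun t => spaceFourier φ ξ t) := by
    have h := (continuous_spaceFourier φ).comp (Continuous.prodMk_right ξ)
    simpa only [Function.comp_def] using h
  have hi : Integrable (𝓕 (spaceFourier φ ξ)) := by
    rw [funext (fourier_spaceFourier φ ξ)]
    exact integrable_freqProfile_snd φ ξ
  exact ⟨hc, integrable_spaceFourier φ ξ, hi⟩

lemma lintegral_enorm_eq_enorm_integral_of_nonneg {f : ℝ → ℂ} (hf : Integrable f)
    (h : ∀ t, 0 ≤ (f t).re ∧ (f t).im = 0) : ∫⁻ t, ‖f t‖ₑ = ‖∫ t, f t‖ₑ := by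
  have e : ∀ t, f t = ((‖f t‖ : ℝ) : ℂ) := fun t => by
    have := h t
    apply Complex.ext
    · rw [Complex.ofReal_re, Complex.norm_def, Complex.normSq_apply, this.2, mul_zero, add_zero,
        Real.sqrt_mul_self this.1]
    · simp [this.2]
  rw [integral_congr_ae (Filter.Eventually.of_forall e), integral_complex_ofReal,
    ← ofReal_integral_norm_eq_lintegral_enorm hf, ← ofReal_norm, Complex.norm_real,
    Real.norm_of_nonneg (integral_nonneg fun _ => norm_nonneg _)]

lemma nonneg_mul_four {z₁ z₂ z₃ z₄ : ℂ} (h₁ : 0 ≤ z₁.re ∧ z₁.im = 0)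
    (h₂ : 0 ≤ z₂.re ∧ z₂.im = 0) (h₃ : 0 ≤ z₃.re ∧ z₃.im = 0) (h₄ : 0 ≤ z₄.re ∧ z₄.im = 0) :
    0 ≤ (z₁ * z₂ * z₃ * z₄).re ∧ (z₁ * z₂ * z₃ * z₄).im = 0 := by
  simp only [Complex.mul_re, Complex.mul_im, h₁.2, h₂.2, h₃.2, h₄.2]
  have := mul_nonneg (mul_nonneg (mul_nonneg h₁.1 h₂.1) h₃.1) h₄.1
  simpa using this

lemma lintegral_enorm_spaceFourier_mul_le (φ₁ φ₂ φ₃ φ₄ : SchwartzMap (Rn 2 × ℝ) ℂ)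
    (ξ₁ ξ₂ ξ₃ ξ₄ : Rn 2)
    (h₁ : ∀ ξ t, 0 ≤ (spaceFourier φ₁ ξ t).re ∧ (spaceFourier φ₁ ξ t).im = 0)
    (h₂ : ∀ ξ t, 0 ≤ (spaceFourier φ₂ ξ t).re ∧ (spaceFourier φ₂ ξ t).im = 0)
    (h₃ : ∀ ξ t, 0 ≤ (spaceFourier φ₃ ξ t).re ∧ (spaceFourier φ₃ ξ t).im = 0)
    (h₄ : ∀ ξ t, 0 ≤ (spaceFourier φ₄ ξ t).re ∧ (spaceFourier φ₄ ξ t).im = 0) :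
    ∫⁻ t, ‖spaceFourier φ₁ ξ₁ t * spaceFourier φ₂ ξ₂ t * spaceFourier φ₃ ξ₃ t *
      spaceFourier φ₄ ξ₄ t‖ₑ ≤ ∫⁻ τ₂, ∫⁻ τ₃, ∫⁻ τ₄,
      ‖freqProfile φ₁ (ξ₁, -τ₂ - τ₃ - τ₄)‖ₑ * ‖freqProfile φ₂ (ξ₂, τ₂)‖ₑ *
        ‖freqProfile φ₃ (ξ₃, τ₃)‖ₑ * ‖freqProfile φ₄ (ξ₄, τ₄)‖ₑ := by
  have a2 := inFourierAlgebra_spaceFourier φ₂ ξ₂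
  have a3 := inFourierAlgebra_spaceFourier φ₃ ξ₃
  have a4 := inFourierAlgebra_spaceFourier φ₄ ξ₄
  have i1 := integrable_spaceFourier φ₁ ξ₁
  rw [lintegral_enorm_eq_enorm_integral_of_nonneg
    (a4.integrable_mul (a3.integrable_mul (a2.integrable_mul i1)))
    (fun t => nonneg_mul_four (h₁ _ _) (h₂ _ _) (h₃ _ _) (h₄ _ _))]
  refine (enorm_integral_mul_four_le i1 a2 a3 a4).trans (le_of_eq ?_)
  simp only [fourier_spaceFourier]

section Tonelli

variable {α β γ δ : Type*} [MeasurableSpace α] [MeasurableSpace β] [MeasurableSpace γ]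
  [MeasurableSpace δ] {μ : Measure α} {ν : Measure β} {ρ : Measure γ} {κ : Measure δ}
  [SFinite μ] [SFinite ν] [SFinite ρ] [SFinite κ]

lemma lintegral_rotate_three {f : α → β → γ → ℝ≥0∞}
    (hf : Measurable fun q : α × β × γ => f q.1 q.2.1 q.2.2) :
    ∫⁻ a, ∫⁻ b, ∫⁻ c, f a b c ∂ρ ∂ν ∂μ = ∫⁻ b, ∫⁻ c, ∫⁻ a, f a b c ∂μ ∂ρ ∂ν := by
  rw [lintegral_lintegral_swap]
  · refine lintegral_congr fun b => lintegral_lintegral_swap (Measurable.aemeasurable ?_)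
    exact hf.comp (g := fun q : α × β × γ => f q.1 q.2.1 q.2.2)
      (f := fun q : α × γ => (q.1, b, q.2)) (by fun_prop)
  · refine Measurable.aemeasurable (Measurable.lintegral_prod_right'
      (f := fun q : (α × β) × γ => f q.1.1 q.1.2 q.2) ?_)
    exact hf.comp (f := fun q : (α × β) × γ => (q.1.1, q.1.2, q.2)) (by fun_prop)

lemma lintegral_rotate_four {f : α → β → γ → δ → ℝ≥0∞}
    (hf : Measurable fun q : α × β × γ × δ => f q.1 q.2.1 q.2.2.1 q.2.2.2) :
    ∫⁻ a, ∫⁻ b, ∫⁻ c, ∫⁻ d, f a b c d ∂κ ∂ρ ∂ν ∂μ =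
      ∫⁻ b, ∫⁻ c, ∫⁻ d, ∫⁻ a, f a b c d ∂μ ∂κ ∂ρ ∂ν := by
  rw [lintegral_rotate_three]
  · refine lintegral_congr fun b => lintegral_congr fun c =>
      lintegral_lintegral_swap (Measurable.aemeasurable ?_)
    exact hf.comp (g := fun q : α × β × γ × δ => f q.1 q.2.1 q.2.2.1 q.2.2.2)
      (f := fun q : α × δ => (q.1, b, c, q.2)) (by fun_prop)
  · refine Measurable.lintegral_prod_right'
      (f := fun q : (α × β × γ) × δ => f q.1.1 q.1.2.1 q.1.2.2 q.2) ?_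
    exact hf.comp (f := fun q : (α × β × γ) × δ => (q.1.1, q.1.2.1, q.1.2.2, q.2)) (by fun_prop)

lemma lintegral_prod_triple {f : (α × β) → (α × β) → (α × β) → ℝ≥0∞}
    (hf : Measurable fun q : (α × β) × (α × β) × (α × β) => f q.1 q.2.1 q.2.2) :
    ∫⁻ a₁, ∫⁻ a₂, ∫⁻ a₃, ∫⁻ b₁, ∫⁻ b₂, ∫⁻ b₃, f (a₁, b₁) (a₂, b₂) (a₃, b₃) ∂ν ∂ν ∂ν ∂μ ∂μ ∂μ =
      ∫⁻ p₁, ∫⁻ p₂, ∫⁻ p₃, f p₁ p₂ p₃ ∂μ.prod ν ∂μ.prod ν ∂μ.prod ν := by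
  have hg : Measurable fun q : (α × β) × (α × β) => ∫⁻ p₃, f q.1 q.2 p₃ ∂μ.prod ν :=
    Measurable.lintegral_prod_right' (f := fun q : ((α × β) × (α × β)) × (α × β) =>
      f q.1.1 q.1.2 q.2) (hf.comp (f := fun q : ((α × β) × (α × β)) × (α × β) =>
        (q.1.1, q.1.2, q.2)) (by fun_prop))
  have hh : Measurable fun p₁ : α × β => ∫⁻ p₂, ∫⁻ p₃, f p₁ p₂ p₃ ∂μ.prod ν ∂μ.prod ν :=
    hg.lintegral_prod_right'
  rw [lintegral_prod _ hh.aemeasurable]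
  refine lintegral_congr fun a₁ => ?_
  have h₁ : ∀ a₂, ∫⁻ a₃, ∫⁻ b₁, ∫⁻ b₂, ∫⁻ b₃, f (a₁, b₁) (a₂, b₂) (a₃, b₃) ∂ν ∂ν ∂ν ∂μ =
      ∫⁻ b₁, ∫⁻ b₂, ∫⁻ p₃, f (a₁, b₁) (a₂, b₂) p₃ ∂μ.prod ν ∂ν ∂ν := fun a₂ => by
    rw [lintegral_rotate_three]
    · refine lintegral_congr fun b₁ => lintegral_congr fun b₂ => ?_
      rw [lintegral_prod]
      exact (hf.comp (g := fun q : (α × β) × (α × β) × (α × β) => f q.1 q.2.1 q.2.2)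
        (f := fun p => ((a₁, b₁), (a₂, b₂), p)) (by fun_prop)).aemeasurable
    · refine Measurable.lintegral_prod_right' (f := fun q : (α × β × β) × β =>
        f (a₁, q.1.2.1) (a₂, q.1.2.2) (q.1.1, q.2)) ?_
      exact hf.comp (f := fun q : (α × β × β) × β =>
        ((a₁, q.1.2.1), (a₂, q.1.2.2), (q.1.1, q.2))) (by fun_prop)
  rw [lintegral_congr h₁, lintegral_lintegral_swap]
  · refine lintegral_congr fun b₁ => ?_
    rw [lintegral_prod]
    exact (hg.comp (f := fun p => ((a₁, b₁), p)) (by fun_prop)).aemeasurable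
  · refine Measurable.aemeasurable (Measurable.lintegral_prod_right' (f := fun q : (α × β) × β =>
      ∫⁻ p₃, f (a₁, q.1.2) (q.1.1, q.2) p₃ ∂μ.prod ν) ?_)
    exact hg.comp (f := fun q : (α × β) × β => ((a₁, q.1.2), (q.1.1, q.2))) (by fun_prop)

end Tonelli

lemma lintegral_enorm_spaceFourier_le_quadForm (φ₁ φ₂ φ₃ φ₄ : SchwartzMap (Rn 2 × ℝ) ℂ)
    (h₁ : ∀ ξ t, 0 ≤ (spaceFourier φ₁ ξ t).re ∧ (spaceFourier φ₁ ξ t).im = 0)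
    (h₂ : ∀ ξ t, 0 ≤ (spaceFourier φ₂ ξ t).re ∧ (spaceFourier φ₂ ξ t).im = 0)
    (h₃ : ∀ ξ t, 0 ≤ (spaceFourier φ₃ ξ t).re ∧ (spaceFourier φ₃ ξ t).im = 0)
    (h₄ : ∀ ξ t, 0 ≤ (spaceFourier φ₄ ξ t).re ∧ (spaceFourier φ₄ ξ t).im = 0) :
    ∫⁻ t, ∫⁻ ξ₂, ∫⁻ ξ₃, ∫⁻ ξ₄, ‖spaceFourier φ₁ (-ξ₂ - ξ₃ - ξ₄) t * spaceFourier φ₂ ξ₂ t *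
      spaceFourier φ₃ ξ₃ t * spaceFourier φ₄ ξ₄ t‖ₑ ≤
    quadForm volume (fun p => ‖freqProfile φ₁ p‖ₑ) (fun p => ‖freqProfile φ₂ p‖ₑ)
      (fun p => ‖freqProfile φ₃ p‖ₑ) (fun p => ‖freqProfile φ₄ p‖ₑ) := by
  have c₁ := continuous_spaceFourier φ₁
  have c₂ := continuous_spaceFourier φ₂
  have c₃ := continuous_spaceFourier φ₃
  have c₄ := continuous_spaceFourier φ₄
  have e₁ := continuous_freqProfile φ₁
  have e₂ := continuous_freqProfile φ₂
  have e₃ := continuous_freqProfile φ₃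
  have e₄ := continuous_freqProfile φ₄
  rw [lintegral_rotate_four]
  · calc _ ≤ ∫⁻ ξ₂, ∫⁻ ξ₃, ∫⁻ ξ₄, ∫⁻ τ₂, ∫⁻ τ₃, ∫⁻ τ₄,
          ‖freqProfile φ₁ (-ξ₂ - ξ₃ - ξ₄, -τ₂ - τ₃ - τ₄)‖ₑ * ‖freqProfile φ₂ (ξ₂, τ₂)‖ₑ *
          ‖freqProfile φ₃ (ξ₃, τ₃)‖ₑ * ‖freqProfile φ₄ (ξ₄, τ₄)‖ₑ :=
          lintegral_mono fun ξ₂ => lintegral_mono fun ξ₃ => lintegral_mono fun ξ₄ =>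
            lintegral_enorm_spaceFourier_mul_le φ₁ φ₂ φ₃ φ₄ _ _ _ _ h₁ h₂ h₃ h₄
      _ = _ := by
          rw [quadForm, Measure.volume_eq_prod]
          refine lintegral_prod_triple (f := fun p₂ p₃ p₄ : Rn 2 × ℝ =>
            ‖freqProfile φ₁ (-p₂ - p₃ - p₄)‖ₑ * ‖freqProfile φ₂ p₂‖ₑ *
            ‖freqProfile φ₃ p₃‖ₑ * ‖freqProfile φ₄ p₄‖ₑ) ?_
          have d₁ := e₁.comp (f := fun q : (Rn 2 × ℝ) × (Rn 2 × ℝ) × (Rn 2 × ℝ) =>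
            -q.1 - q.2.1 - q.2.2) (by fun_prop)
          have m₁ := d₁.enorm.measurable
          have m₂ := ((e₂.comp continuous_fst).enorm : Continuous fun q : (Rn 2 × ℝ) ×
            (Rn 2 × ℝ) × (Rn 2 × ℝ) => _).measurable
          have m₃ := ((e₃.comp (continuous_fst.comp continuous_snd)).enorm : Continuous
            fun q : (Rn 2 × ℝ) × (Rn 2 × ℝ) × (Rn 2 × ℝ) => _).measurable
          have m₄ := ((e₄.comp (continuous_snd.comp continuous_snd)).enorm : Continuous
            fun q : (Rn 2 × ℝ) × (Rn 2 × ℝ) × (Rn 2 × ℝ) => _).measurable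
          exact ((m₁.mul m₂).mul m₃).mul m₄
  · refine Continuous.measurable (Continuous.enorm ?_)
    have d₁ := c₁.comp (f := fun q : ℝ × Rn 2 × Rn 2 × Rn 2 =>
      (-q.2.1 - q.2.2.1 - q.2.2.2, q.1)) (by fun_prop)
    have d₂ := c₂.comp (f := fun q : ℝ × Rn 2 × Rn 2 × Rn 2 => (q.2.1, q.1)) (by fun_prop)
    have d₃ := c₃.comp (f := fun q : ℝ × Rn 2 × Rn 2 × Rn 2 => (q.2.2.1, q.1)) (by fun_prop)
    have d₄ := c₄.comp (f := fun q : ℝ × Rn 2 × Rn 2 × Rn 2 => (q.2.2.2, q.1)) (by fun_prop)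
    simp only [Function.comp_def] at d₁ d₂ d₃ d₄
    exact ((d₁.mul d₂).mul d₃).mul d₄

/-- The integrand of the squared `X_{s,b}` norm. -/
def xDensity (s b : ℝ) (φ : SchwartzMap (Rn 2 × ℝ) ℂ) (p : Rn 2 × ℝ) : ℝ :=
  jap p.1 ^ (2 * s) * japR (p.2 - ‖p.1‖ ^ 2) ^ (2 * b) * ‖freqProfile φ p‖ ^ 2

lemma one_le_jap {n : ℕ} (ξ : Rn n) : 1 ≤ jap ξ :=
  Real.one_le_sqrt.mpr (by nlinarith [sq_nonneg ‖ξ‖])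

lemma one_le_japR (x : ℝ) : 1 ≤ japR x := Real.one_le_sqrt.mpr (by nlinarith [sq_nonneg x])

lemma jap_le_one_add_norm {n : ℕ} (ξ : Rn n) : jap ξ ≤ 1 + ‖ξ‖ :=
  Real.sqrt_le_iff.mpr ⟨by positivity, by nlinarith [norm_nonneg ξ]⟩

lemma japR_le_one_add_abs (x : ℝ) : japR x ≤ 1 + |x| :=
  Real.sqrt_le_iff.mpr ⟨by positivity, by nlinarith [abs_nonneg x, sq_abs x]⟩

lemma xDensity_nonneg (s b : ℝ) (φ : SchwartzMap (Rn 2 × ℝ) ℂ) (p : Rn 2 × ℝ) :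
    0 ≤ xDensity s b φ p := by
  have := one_le_jap p.1
  have := (japR_pos (p.2 - ‖p.1‖ ^ 2)).le
  unfold xDensity
  positivity

lemma integrable_xDensity {s b : ℝ} (hs : s ≤ 1) (hb : b ≤ 1)
    (φ : SchwartzMap (Rn 2 × ℝ) ℂ) : Integrable (xDensity s b φ) := by
  obtain ⟨C, hC0, hC⟩ := exists_freqProfile_decay φ 5
  have hd : Integrable (fun p : Rn 2 × ℝ => C ^ 2 * (1 + ‖p‖) ^ (-(4 : ℝ))) :=
    (integrable_one_add_norm (by simp; norm_num)).const_mul _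
  have hc : Continuous (xDensity s b φ) := by
    have h1 := continuous_freqProfile φ
    have h2 : Continuous (fun p : Rn 2 × ℝ => jap p.1 ^ (2 * s)) :=
      (continuous_jap.comp continuous_fst).rpow_const fun p => Or.inl (by
        have := one_le_jap p.1; simp only [Function.comp_apply]; positivity)
    have h3 : Continuous (fun p : Rn 2 × ℝ => japR (p.2 - ‖p.1‖ ^ 2) ^ (2 * b)) :=
      (continuous_japR.comp (by fun_prop)).rpow_const fun p => Or.inl (japR_pos _).ne'
    exact (h2.mul h3).mul (h1.norm.pow 2)
  refine hd.mono' hc.aestronglyMeasurable (Filter.Eventually.of_forall fun p => ?_)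
  rw [Real.norm_of_nonneg (xDensity_nonneg s b φ p), Real.rpow_neg (by positivity),
    ← div_eq_mul_inv, le_div_iff₀ (by positivity)]
  norm_cast
  have n1 : ‖p.1‖ ≤ ‖p‖ := norm_fst_le p
  have n2 : |p.2| ≤ ‖p‖ := norm_snd_le p
  have hA : jap p.1 ^ (2 * s) ≤ (1 + ‖p‖) ^ 2 := by
    calc jap p.1 ^ (2 * s) ≤ jap p.1 ^ (2 : ℝ) :=
          Real.rpow_le_rpow_of_exponent_le (one_le_jap _) (by linarith)
      _ = jap p.1 ^ 2 := by norm_cast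
      _ ≤ _ := by
          have := one_le_jap p.1
          have := jap_le_one_add_norm p.1
          gcongr
          linarith
  have hB : japR (p.2 - ‖p.1‖ ^ 2) ^ (2 * b) ≤ (1 + ‖p‖) ^ 4 := by
    have hj := japR_le_one_add_abs (p.2 - ‖p.1‖ ^ 2)
    have h0 := one_le_japR (p.2 - ‖p.1‖ ^ 2)
    have ha : |p.2 - ‖p.1‖ ^ 2| ≤ ‖p‖ + ‖p‖ ^ 2 := by
      refine (abs_sub _ _).trans ?_
      rw [abs_of_nonneg (sq_nonneg ‖p.1‖)]
      gcongr
    calc japR (p.2 - ‖p.1‖ ^ 2) ^ (2 * b) ≤ japR (p.2 - ‖p.1‖ ^ 2) ^ (2 : ℝ) :=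
          Real.rpow_le_rpow_of_exponent_le h0 (by linarith)
      _ = japR (p.2 - ‖p.1‖ ^ 2) ^ 2 := by norm_cast
      _ ≤ ((1 + ‖p‖) ^ 2) ^ 2 := by
          gcongr
          nlinarith [norm_nonneg p]
      _ = _ := by ring
  have hj := (japR_pos (p.2 - ‖p.1‖ ^ 2)).le
  calc xDensity s b φ p * (1 + ‖p‖) ^ 4
      ≤ ((1 + ‖p‖) ^ 2 * (1 + ‖p‖) ^ 4 * ‖freqProfile φ p‖ ^ 2) * (1 + ‖p‖) ^ 4 := by
        unfold xDensity
        gcongr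
    _ = ((1 + ‖p‖) ^ 5 * ‖freqProfile φ p‖) ^ 2 := by ring
    _ ≤ C ^ 2 := by
        gcongr
        exact hC p

lemma sq_XNorm_eq {s b : ℝ} (hs : s ≤ 1) (hb : b ≤ 1)
    (φ : SchwartzMap (Rn 2 × ℝ) ℂ) :
    XNorm 2 s b (fun x t => φ (x, t)) ^ 2 = ∫ p, xDensity s b φ p := by
  have e : ∫ p, xDensity s b φ p = ∫ ξ : Rn 2, ∫ τ : ℝ, jap ξ ^ (2 * s) *
      japR (τ - ‖ξ‖ ^ 2) ^ (2 * b) * ‖stFourier 2 (fun x t => φ (x, t)) ξ τ‖ ^ 2 :=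
    integral_prod _ (integrable_xDensity hs hb φ)
  rw [XNorm, ← e, ← Real.rpow_natCast, ← Real.rpow_mul
    (integral_nonneg (xDensity_nonneg s b φ))]
  norm_num

lemma XNorm_nonneg (s b : ℝ) (φ : SchwartzMap (Rn 2 × ℝ) ℂ) :
    0 ≤ XNorm 2 s b (fun x t => φ (x, t)) := by
  refine Real.rpow_nonneg (integral_nonneg fun ξ => integral_nonneg fun τ => ?_) _
  exact xDensity_nonneg s b φ (ξ, τ)

lemma profileEnergy_le {s b K : ℝ} (hs : s ≤ 1) (hb : b ≤ 1)
    (φ : SchwartzMap (Rn 2 × ℝ) ℂ) (hK : 0 ≤ K)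
    (h : ∀ p, freqProfile φ p ≠ 0 → 1 ≤ K * jap p.1 ^ (2 * s)) :
    profileEnergy b (fun p => ‖freqProfile φ p‖ₑ) ≤
      ENNReal.ofReal (K * XNorm 2 s b (fun x t => φ (x, t)) ^ 2) := by
  rw [sq_XNorm_eq hs hb, ← integral_const_mul,
    ofReal_integral_eq_lintegral_ofReal ((integrable_xDensity hs hb φ).const_mul K)
    (Filter.Eventually.of_forall fun p => mul_nonneg hK (xDensity_nonneg s b φ p))]
  refine lintegral_mono fun p => ?_
  have hj := japR_pos (p.2 - ‖p.1‖ ^ 2)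
  simp only [paraWeight, dispWeight]
  rw [← ofReal_norm, ← ENNReal.ofReal_pow (norm_nonneg _),
    ← ENNReal.ofReal_div_of_pos (Real.rpow_pos_of_pos hj _)]
  apply ENNReal.ofReal_le_ofReal
  rw [Real.rpow_neg hj.le, div_inv_eq_mul, xDensity]
  by_cases hp : freqProfile φ p = 0
  · simp [hp]
  · have := h p hp
    have h2 : 0 ≤ ‖freqProfile φ p‖ ^ 2 * japR (p.2 - ‖p.1‖ ^ 2) ^ (2 * b) := by positivity
    nlinarith

/-- Nonnegativity of the spatial Fourier transform, with support in `M ≤ ⟨ξ⟩ ≤ 2M`. -/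
structure IsNonnegLocalized (M : ℝ) (φ : SchwartzMap (Rn 2 × ℝ) ℂ) : Prop where
  nonneg : ∀ ξ t, 0 ≤ (spaceFourier φ ξ t).re ∧ (spaceFourier φ ξ t).im = 0
  support : ∀ ξ t, spaceFourier φ ξ t ≠ 0 → M ≤ jap ξ ∧ jap ξ ≤ 2 * M

lemma IsNonnegLocalized.freqProfile_support {M : ℝ} {φ : SchwartzMap (Rn 2 × ℝ) ℂ}
    (h : IsNonnegLocalized M φ) {p : Rn 2 × ℝ} (hp : freqProfile φ p ≠ 0) :
    M ≤ jap p.1 ∧ jap p.1 ≤ 2 * M := by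
  by_contra hc
  refine hp (freqProfile_eq_zero φ (ξ := p.1) (fun t => ?_) p.2)
  by_contra hne
  exact hc (h.support _ _ hne)

lemma IsNonnegLocalized.profileEnergy_le_neg_one {b M : ℝ} (hb : b ≤ 1) (hM : 1 ≤ M)
    {φ : SchwartzMap (Rn 2 × ℝ) ℂ} (h : IsNonnegLocalized M φ) :
    profileEnergy b (fun p => ‖freqProfile φ p‖ₑ) ≤
      ENNReal.ofReal ((2 * M * XNorm 2 (-1) b (fun x t => φ (x, t))) ^ 2) := by
  rw [mul_pow]
  refine profileEnergy_le (by norm_num) hb φ (by positivity) fun p hp => ?_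
  have h1 := one_le_jap p.1
  have h2 := (h.freqProfile_support hp).2
  rw [show (2 : ℝ) * (-1) = -((2 : ℕ) : ℝ) by norm_num, Real.rpow_neg (by positivity),
    Real.rpow_natCast, ← div_eq_mul_inv, one_le_div (by positivity)]
  gcongr

lemma IsNonnegLocalized.profileEnergy_le_one {b M : ℝ} (hb : b ≤ 1) (hM : 1 ≤ M)
    {φ : SchwartzMap (Rn 2 × ℝ) ℂ} (h : IsNonnegLocalized M φ) :
    profileEnergy b (fun p => ‖freqProfile φ p‖ₑ) ≤
      ENNReal.ofReal ((M⁻¹ * XNorm 2 1 b (fun x t => φ (x, t))) ^ 2) := by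
  rw [mul_pow]
  refine profileEnergy_le le_rfl hb φ (by positivity) fun p hp => ?_
  have h1 := one_le_jap p.1
  have h2 := (h.freqProfile_support hp).1
  rw [show (2 : ℝ) * 1 = ((2 : ℕ) : ℝ) by norm_num, Real.rpow_natCast, inv_pow,
    inv_mul_eq_div, one_le_div (by positivity)]
  gcongr

lemma exists_lintegral_enorm_spaceFourier_le {b : ℝ} (hb : 1 / 2 < b) (hb1 : b ≤ 1) :
    ∃ C : ℝ, 0 < C ∧ ∀ M₁ M₂ M₃ M₄ : ℝ, 1 ≤ M₁ → 1 ≤ M₂ → 1 ≤ M₃ → 1 ≤ M₄ →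
      ∀ φ₁ φ₂ φ₃ φ₄ : SchwartzMap (Rn 2 × ℝ) ℂ, IsNonnegLocalized M₁ φ₁ →
      IsNonnegLocalized M₂ φ₂ → IsNonnegLocalized M₃ φ₃ → IsNonnegLocalized M₄ φ₄ →
      ∫⁻ t, ∫⁻ ξ₂, ∫⁻ ξ₃, ∫⁻ ξ₄, ‖spaceFourier φ₁ (-ξ₂ - ξ₃ - ξ₄) t * spaceFourier φ₂ ξ₂ t *
        spaceFourier φ₃ ξ₃ t * spaceFourier φ₄ ξ₄ t‖ₑ ≤
      ENNReal.ofReal (C * (√(M₃ / M₁) * √(M₄ / M₂) * (M₁ / (M₂ * M₃ * M₄))) *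
        (XNorm 2 (-1) b (fun x t => φ₁ (x, t)) * XNorm 2 1 b (fun x t => φ₂ (x, t)) *
        XNorm 2 1 b (fun x t => φ₃ (x, t)) * XNorm 2 1 b (fun x t => φ₄ (x, t)))) := by
  obtain ⟨C, hC, h⟩ := exists_sq_quadForm_le hb
  refine ⟨2 * √C, by positivity, ?_⟩
  intro M₁ M₂ M₃ M₄ h1 h2 h3 h4 φ₁ φ₂ φ₃ φ₄ l1 l2 l3 l4
  refine (lintegral_enorm_spaceFourier_le_quadForm φ₁ φ₂ φ₃ φ₄ l1.nonneg l2.nonneg l3.nonneg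
    l4.nonneg).trans ?_
  have hm := fun φ : SchwartzMap (Rn 2 × ℝ) ℂ => (continuous_freqProfile φ).enorm.measurable
  have key := h M₁ M₂ M₃ M₄ h1 h2 h3 h4 _ _ _ _ (hm φ₁) (hm φ₂) (hm φ₃) (hm φ₄)
    (fun p hp => (l1.freqProfile_support (enorm_ne_zero.mp hp)).1)
    (fun p hp => (l2.freqProfile_support (enorm_ne_zero.mp hp)).1)
    (fun p hp => (l3.freqProfile_support (enorm_ne_zero.mp hp)).2)
    (fun p hp => (l4.freqProfile_support (enorm_ne_zero.mp hp)).2)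
  have hE := mul_le_mul' (mul_le_mul' (mul_le_mul' (l1.profileEnergy_le_neg_one hb1 h1)
    (l2.profileEnergy_le_one hb1 h2)) (l3.profileEnergy_le_one hb1 h3))
    (l4.profileEnergy_le_one hb1 h4)
  have key' := key.trans (mul_le_mul' le_rfl hE)
  have x1 := XNorm_nonneg (-1) b φ₁
  have x2 := XNorm_nonneg 1 b φ₂
  have x3 := XNorm_nonneg 1 b φ₃
  have x4 := XNorm_nonneg 1 b φ₄
  set X₁ := XNorm 2 (-1) b (fun x t => φ₁ (x, t))
  set X₂ := XNorm 2 1 b (fun x t => φ₂ (x, t))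
  set X₃ := XNorm 2 1 b (fun x t => φ₃ (x, t))
  set X₄ := XNorm 2 1 b (fun x t => φ₄ (x, t))
  rw [← ENNReal.ofReal_mul (by positivity), ← ENNReal.ofReal_mul (by positivity),
    ← ENNReal.ofReal_mul (by positivity), ← ENNReal.ofReal_mul (by positivity)] at key'
  have hsq : C * (M₃ / M₁ * (M₄ / M₂)) * ((2 * M₁ * X₁) ^ 2 * (M₂⁻¹ * X₂) ^ 2 * (M₃⁻¹ * X₃) ^ 2 *
      (M₄⁻¹ * X₄) ^ 2) = (2 * √C * (√(M₃ / M₁) * √(M₄ / M₂) * (M₁ / (M₂ * M₃ * M₄))) *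
        (X₁ * X₂ * X₃ * X₄)) ^ 2 := by
    have a1 := Real.sq_sqrt hC.le
    have a2 : √(M₃ / M₁) ^ 2 = M₃ / M₁ := Real.sq_sqrt (by positivity)
    have a3 : √(M₄ / M₂) ^ 2 = M₄ / M₂ := Real.sq_sqrt (by positivity)
    simp only [mul_pow, a1, a2, a3, div_pow, inv_pow]
    field_simp
  rw [hsq, ENNReal.ofReal_pow (by positivity)] at key'
  exact (ENNReal.pow_le_pow_left_iff two_ne_zero).mp key'

section Multiplier

variable {s : ℝ} {m : Rn 2 → ℝ}

lemma IsAdmissibleMultiplier.half_le (hm : IsAdmissibleMultiplier 2 s m) (hs0 : 0 ≤ s)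
    {ξ : Rn 2} (h : ‖ξ‖ ≤ 2) : 1 / 2 ≤ m ξ := by
  obtain ⟨-, -, -, hmono, -, hpow⟩ := hm
  have hn : ‖(EuclideanSpace.single 0 2 : Rn 2)‖ = 2 := by simp
  have h1 := hmono ξ _ (h.trans hn.ge)
  rw [hpow _ hn.ge, hn] at h1
  refine le_trans ?_ h1
  calc (1 / 2 : ℝ) = 2 ^ (-(1 : ℝ)) := by norm_num [Real.rpow_neg]
    _ ≤ 2 ^ (-(1 - s)) := Real.rpow_le_rpow_of_exponent_le (by norm_num) (by linarith)

lemma IsAdmissibleMultiplier.lower (hm : IsAdmissibleMultiplier 2 s m) (hs0 : 0 ≤ s)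
    (hs1 : s ≤ 1) (ξ : Rn 2) : 1 / 2 * (1 + ‖ξ‖) ^ (-(1 - s)) ≤ m ξ := by
  rcases le_total ‖ξ‖ 2 with h | h
  · have h1 := hm.half_le hs0 h
    have h2 : (1 + ‖ξ‖) ^ (-(1 - s)) ≤ 1 :=
      Real.rpow_le_one_of_one_le_of_nonpos (by linarith [norm_nonneg ξ]) (by linarith)
    linarith
  · rw [hm.2.2.2.2.2 ξ h]
    have h2 : (1 + ‖ξ‖) ^ (-(1 - s)) ≤ ‖ξ‖ ^ (-(1 - s)) :=
      Real.rpow_le_rpow_of_nonpos (by linarith) (by linarith) (by linarith)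
    have h3 : 0 ≤ (1 + ‖ξ‖) ^ (-(1 - s)) := by positivity
    linarith

lemma rpow_neg_le_mul_of_le_mul {a x y c : ℝ} (ha0 : 0 ≤ a) (ha1 : a ≤ 1) (hc : 1 ≤ c)
    (hx : 0 < x) (hy : 0 < y) (h : y ≤ c * x) : x ^ (-a) ≤ c * y ^ (-a) := by
  have hc0 : 0 < c := by linarith
  rw [Real.rpow_neg hx.le, Real.rpow_neg hy.le, ← div_eq_mul_inv, ← one_div,
    div_le_div_iff₀ (by positivity) (by positivity), one_mul]
  calc y ^ a ≤ (c * x) ^ a := Real.rpow_le_rpow hy.le h ha0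
    _ = c ^ a * x ^ a := Real.mul_rpow hc0.le hx.le
    _ ≤ c ^ (1 : ℝ) * x ^ a := by
        gcongr
    _ = c * x ^ a := by rw [Real.rpow_one]

lemma IsAdmissibleMultiplier.upper (hm : IsAdmissibleMultiplier 2 s m) (hs0 : 0 ≤ s)
    (hs1 : s ≤ 1) (ξ : Rn 2) : m ξ ≤ 3 * (1 + ‖ξ‖) ^ (-(1 - s)) := by
  have h0 := norm_nonneg ξ
  rcases le_total ‖ξ‖ 2 with h | h
  · have h1 := (hm.2.1 ξ).2
    have h2 := rpow_neg_le_mul_of_le_mul (a := 1 - s) (x := 1) (y := 1 + ‖ξ‖) (c := 3)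
      (by linarith) (by linarith) (by norm_num) one_pos (by linarith) (by linarith)
    rw [Real.one_rpow] at h2
    linarith
  · rw [hm.2.2.2.2.2 ξ h]
    exact rpow_neg_le_mul_of_le_mul (by linarith) (by linarith) (by norm_num) (by linarith)
      (by linarith) (by linarith)

lemma abs_one_sub_rpow_neg_le {a x : ℝ} (ha0 : 0 ≤ a) (ha1 : a ≤ 1) (hx : 0 < x) :
    |1 - x ^ (-a)| ≤ |x - 1| / x := by
  have hinv : x ^ (-(1 : ℝ)) = 1 / x := by rw [Real.rpow_neg_one, one_div]
  have hdiv : 1 - 1 / x = (x - 1) / x := by field_simp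
  rcases le_total 1 x with h | h
  · have h1 : x ^ (-a) ≤ 1 := Real.rpow_le_one_of_one_le_of_nonpos h (by linarith)
    have h2 : x ^ (-(1 : ℝ)) ≤ x ^ (-a) := Real.rpow_le_rpow_of_exponent_le h (by linarith)
    rw [abs_of_nonneg (by linarith), abs_of_nonneg (by linarith), ← hdiv, ← hinv]
    linarith
  · have h1 : 1 ≤ x ^ (-a) := Real.one_le_rpow_of_pos_of_le_one_of_nonpos hx h (by linarith)
    have h2 : x ^ (-a) ≤ x ^ (-(1 : ℝ)) := Real.rpow_le_rpow_of_exponent_ge hx h (by linarith)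
    rw [abs_of_nonpos (by linarith), abs_of_nonpos (by linarith), neg_div, ← hdiv, ← hinv]
    linarith

lemma IsAdmissibleMultiplier.exists_lipschitz (hm : IsAdmissibleMultiplier 2 s m) (hs0 : 0 ≤ s)
    (hs1 : s ≤ 1) : ∃ C : ℝ, 0 < C ∧ ∀ η ζ : Rn 2, ‖ζ‖ ≤ 1 / 2 →
      |m η - m (η + ζ)| ≤ C * (‖ζ‖ / (1 + ‖η‖)) * m η := by
  obtain ⟨K, hK⟩ : ∃ K : ℝ, ∀ x ∈ Metric.closedBall (0 : Rn 2) 3, ‖fderiv ℝ m x‖ ≤ K :=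
    (isCompact_closedBall (0 : Rn 2) 3).exists_bound_of_continuousOn
      (hm.1.continuous_fderiv (by simp)).continuousOn
  have hK0 : 0 ≤ K := (norm_nonneg _).trans (hK 0 (by simp))
  refine ⟨25 * K + 4, by positivity, fun η ζ hζ => ?_⟩
  have hη := norm_nonneg η
  have hz := norm_nonneg ζ
  have hmp := (hm.2.1 η).1
  rcases le_total ‖η‖ (5 / 2) with h | h
  · have hL : ‖m η - m (η + ζ)‖ ≤ K * ‖η - (η + ζ)‖ := by
      refine (convex_closedBall (0 : Rn 2) 3).norm_image_sub_le_of_norm_fderiv_le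
        (fun x _ => (hm.1.differentiable (by simp)).differentiableAt) hK ?_ ?_
      · rw [mem_closedBall_zero_iff]
        exact (norm_add_le _ _).trans (by linarith)
      · rw [mem_closedBall_zero_iff]; linarith
    rw [Real.norm_eq_abs, sub_add_cancel_left, norm_neg] at hL
    have h1 := hm.lower hs0 hs1 η
    have h2 := rpow_neg_le_mul_of_le_mul (a := 1 - s) (x := 1) (y := 1 + ‖η‖) (c := 7 / 2)
      (by linarith) (by linarith) (by norm_num) one_pos (by linarith) (by linarith)
    rw [Real.one_rpow] at h2
    have h3 : 1 / 7 ≤ m η := by linarith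
    have h4 : 1 ≤ 25 * (m η / (1 + ‖η‖)) := by
      rw [← mul_div_assoc, le_div_iff₀ (by linarith)]
      linarith
    calc |m η - m (η + ζ)| ≤ K * ‖ζ‖ * 1 := by linarith
      _ ≤ K * ‖ζ‖ * (25 * (m η / (1 + ‖η‖))) := by gcongr
      _ = 25 * K * (‖ζ‖ / (1 + ‖η‖)) * m η := by ring
      _ ≤ _ := by gcongr; linarith
  · have hρ1 : ‖η‖ - ‖ζ‖ ≤ ‖η + ζ‖ := by
      have := norm_sub_norm_le η (-ζ)
      rwa [norm_neg, sub_neg_eq_add] at this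
    have hρ2 : ‖η + ζ‖ ≤ ‖η‖ + ‖ζ‖ := norm_add_le _ _
    have hr : 0 < ‖η‖ := by linarith
    rw [hm.2.2.2.2.2 η (by linarith), hm.2.2.2.2.2 (η + ζ) (by linarith)]
    set x := ‖η + ζ‖ / ‖η‖ with hx
    have hxe : ‖η + ζ‖ = ‖η‖ * x := by rw [hx]; field_simp
    have hx12 : 1 / 2 ≤ x := by rw [hx, le_div_iff₀ hr]; linarith
    have hx1 : |x - 1| ≤ ‖ζ‖ / ‖η‖ := by
      rw [hx, div_sub_one hr.ne', abs_div, abs_of_pos hr]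
      gcongr
      exact abs_le.mpr ⟨by linarith, by linarith⟩
    have key := abs_one_sub_rpow_neg_le (a := 1 - s) (by linarith) (by linarith)
      (show 0 < x by linarith)
    rw [hxe, Real.mul_rpow hr.le (by linarith)]
    have hp : 0 < ‖η‖ ^ (-(1 - s)) := by positivity
    rw [show ‖η‖ ^ (-(1 - s)) - ‖η‖ ^ (-(1 - s)) * x ^ (-(1 - s)) =
      (1 - x ^ (-(1 - s))) * ‖η‖ ^ (-(1 - s)) by ring, abs_mul, abs_of_pos hp]
    gcongr
    calc |1 - x ^ (-(1 - s))| ≤ |x - 1| / x := key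
      _ ≤ (‖ζ‖ / ‖η‖) / (1 / 2) := by gcongr
      _ = 2 * ‖ζ‖ / ‖η‖ := by ring
      _ ≤ 4 * ‖ζ‖ / (1 + ‖η‖) := by
          rw [div_le_div_iff₀ hr (by linarith)]
          nlinarith
      _ = 4 * (‖ζ‖ / (1 + ‖η‖)) := by ring
      _ ≤ _ := by gcongr; linarith

end Multiplier

/-- The majorant `(1 + x / N)^{-a} √x` of the multiplier at frequency `x`, weighted by `√x`. -/
def rootWeight (a N x : ℝ) : ℝ := (1 + x / N) ^ (-a) * √x

lemma rootWeight_pos {a N x : ℝ} (hN : 0 < N) (hx : 0 < x) : 0 < rootWeight a N x := by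
  unfold rootWeight
  positivity

lemma rootWeight_le {a N x y c : ℝ} (ha0 : 0 ≤ a) (ha : a ≤ 1 / 2) (hN : 0 < N) (hx : 0 < x)
    (hy : 0 < y) (hc : 1 ≤ c) (h : x ≤ c ^ 2 * y) : rootWeight a N x ≤ c * rootWeight a N y := by
  have hc0 : 0 < c := by linarith
  have hsx : √x ≤ c * √y := by
    rw [← Real.sqrt_sq hc0.le, ← Real.sqrt_mul (sq_nonneg c)]
    exact Real.sqrt_le_sqrt h
  unfold rootWeight
  rcases le_total y x with hyx | hxy
  · have h1 : (1 + x / N) ^ (-a) ≤ (1 + y / N) ^ (-a) :=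
      Real.rpow_le_rpow_of_nonpos (by positivity) (by gcongr) (by linarith)
    calc (1 + x / N) ^ (-a) * √x ≤ (1 + y / N) ^ (-a) * (c * √y) := by gcongr
      _ = _ := by ring
  · have hx1 : (1 + y / N) / (1 + x / N) ≤ y / x := by
      rw [div_le_div_iff₀ (by positivity) hx]
      have : y / N * x = y * (x / N) := by ring
      linarith
    have h1 : ((1 + y / N) / (1 + x / N)) ^ a ≤ √y / √x := by
      have hge : 1 ≤ (1 + y / N) / (1 + x / N) := by
        rw [one_le_div (by positivity)]; gcongr
      calc ((1 + y / N) / (1 + x / N)) ^ a ≤ ((1 + y / N) / (1 + x / N)) ^ (1 / 2 : ℝ) :=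
            Real.rpow_le_rpow_of_exponent_le hge ha
        _ ≤ (y / x) ^ (1 / 2 : ℝ) := by gcongr
        _ = √y / √x := by rw [← Real.sqrt_eq_rpow, Real.sqrt_div hy.le]
    rw [Real.div_rpow (by positivity) (by positivity),
      div_le_div_iff₀ (by positivity) (by positivity)] at h1
    have hX : 0 < (1 + x / N) ^ a := by positivity
    have hY : 0 < (1 + y / N) ^ a := by positivity
    have h2 : (1 + x / N) ^ (-a) * √x ≤ (1 + y / N) ^ (-a) * √y := by
      rw [Real.rpow_neg (by positivity), Real.rpow_neg (by positivity), inv_mul_eq_div,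
        inv_mul_eq_div, div_le_div_iff₀ hX hY]
      linarith
    have h3 : 0 ≤ (1 + y / N) ^ (-a) * √y := by positivity
    nlinarith

lemma half_sqrt_le_rootWeight {a N x : ℝ} (ha0 : 0 ≤ a) (ha : a ≤ 1 / 2) (hN : 0 < N)
    (hx : 0 ≤ x) (hxN : x ≤ N) : 1 / 2 * √x ≤ rootWeight a N x := by
  unfold rootWeight
  gcongr
  have h := rpow_neg_le_mul_of_le_mul (a := a) (x := 1) (y := 1 + x / N) (c := 2)
      (by linarith) (by linarith) (by norm_num) one_pos (by positivity)
      (by have := (div_le_one hN).mpr hxN; linarith)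
  rw [Real.one_rpow] at h
  linarith

lemma jap_add_le {n : ℕ} (ξ η : Rn n) : jap (ξ + η) ≤ jap ξ + ‖η‖ := by
  have h1 := one_le_jap ξ
  have hξ : jap ξ ^ 2 = 1 + ‖ξ‖ ^ 2 := Real.sq_sqrt (by positivity)
  have h2 : ‖ξ‖ ≤ jap ξ := by nlinarith [norm_nonneg ξ]
  refine Real.sqrt_le_iff.mpr ⟨by positivity, ?_⟩
  have h3 := norm_add_le ξ η
  calc 1 + ‖ξ + η‖ ^ 2 ≤ 1 + (‖ξ‖ + ‖η‖) ^ 2 := by gcongr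
    _ = jap ξ ^ 2 + 2 * ‖ξ‖ * ‖η‖ + ‖η‖ ^ 2 := by rw [hξ]; ring
    _ ≤ jap ξ ^ 2 + 2 * jap ξ * ‖η‖ + ‖η‖ ^ 2 := by gcongr
    _ = _ := by ring

lemma jap_neg {n : ℕ} (ξ : Rn n) : jap (-ξ) = jap ξ := by simp [jap]

section ScaledMultiplier

variable {s N : ℝ} {m : Rn 2 → ℝ}

lemma IsAdmissibleMultiplier.mN_eq_one (hm : IsAdmissibleMultiplier 2 s m) (hN : 0 < N)
    {ξ : Rn 2} (h : ‖ξ‖ ≤ N) : mN m N ξ = 1 := by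
  refine hm.2.2.2.2.1 _ ?_
  rw [norm_smul, norm_inv, Real.norm_of_nonneg hN.le, inv_mul_le_iff₀ hN, mul_one]
  exact h

lemma IsAdmissibleMultiplier.mN_pos (hm : IsAdmissibleMultiplier 2 s m) (ξ : Rn 2) :
    0 < mN m N ξ := (hm.2.1 _).1

lemma norm_inv_smul_eq (hN : 0 < N) (ξ : Rn 2) : ‖N⁻¹ • ξ‖ = ‖ξ‖ / N := by
  rw [norm_smul, norm_inv, Real.norm_of_nonneg hN.le, inv_mul_eq_div]

lemma IsAdmissibleMultiplier.mN_le (hm : IsAdmissibleMultiplier 2 s m) (hs0 : 0 ≤ s)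
    (hs1 : s ≤ 1) (hN : 1 ≤ N) {M : ℝ} (hM : 0 < M) {ξ : Rn 2} (h : M ≤ jap ξ) :
    mN m N ξ ≤ 6 * (1 + M / N) ^ (-(1 - s)) := by
  have hN0 : 0 < N := by linarith
  have h1 := hm.upper hs0 hs1 (N⁻¹ • ξ)
  rw [norm_inv_smul_eq hN0] at h1
  have h2 := rpow_neg_le_mul_of_le_mul (a := 1 - s) (x := 1 + ‖ξ‖ / N) (y := 1 + M / N) (c := 2)
    (by linarith) (by linarith) (by norm_num) (by positivity) (by positivity) (by
      have h3 := jap_le_one_add_norm ξ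
      have h4 : M / N ≤ (N + ‖ξ‖) / N := by gcongr; linarith
      rw [add_div, div_self hN0.ne'] at h4
      linarith [div_nonneg (norm_nonneg ξ) hN0.le])
  have h5 : mN m N ξ = m (N⁻¹ • ξ) := rfl
  linarith

lemma IsAdmissibleMultiplier.le_mN (hm : IsAdmissibleMultiplier 2 s m) (hs0 : 0 ≤ s)
    (hs1 : s ≤ 1) (hN : 1 ≤ N) {M : ℝ} (hM : 0 < M) {ξ : Rn 2} (h : jap ξ ≤ 2 * M) :
    1 / 4 * (1 + M / N) ^ (-(1 - s)) ≤ mN m N ξ := by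
  have hN0 : 0 < N := by linarith
  have h1 := hm.lower hs0 hs1 (N⁻¹ • ξ)
  rw [norm_inv_smul_eq hN0] at h1
  have h2 := rpow_neg_le_mul_of_le_mul (a := 1 - s) (x := 1 + M / N) (y := 1 + ‖ξ‖ / N) (c := 2)
    (by linarith) (by linarith) (by norm_num) (by positivity) (by positivity) (by
      have h4 : ‖ξ‖ / N ≤ (2 * M) / N := by gcongr; exact (norm_le_jap ξ).trans h
      rw [mul_div_assoc] at h4
      linarith)
  have h5 : mN m N ξ = m (N⁻¹ • ξ) := rfl
  linarith

end ScaledMultiplier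

/-- The commutator symbol `1 - m_N(ξ₂ + ξ₃ + ξ₄) / (m_N(ξ₂) m_N(ξ₃) m_N(ξ₄))`. -/
def commSymbol (m : Rn 2 → ℝ) (N : ℝ) (ξ₂ ξ₃ ξ₄ : Rn 2) : ℝ :=
  1 - mN m N (ξ₂ + ξ₃ + ξ₄) / (mN m N ξ₂ * mN m N ξ₃ * mN m N ξ₄)

lemma sqrt_div_mul_sqrt_div_eq {N₁ N₂ N₃ N₄ : ℝ} (h1 : 0 < N₁) (h2 : 0 < N₂) (h3 : 0 < N₃)
    (h4 : 0 < N₄) : √(N₃ / N₁) * √(N₄ / N₂) * (N₁ / (N₂ * N₃ * N₄)) =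
      √N₁ / (N₂ * (√N₂ * √N₃ * √N₄)) := by
  rw [Real.sqrt_div h3.le, Real.sqrt_div h4.le]
  have e1 := Real.sq_sqrt h1.le
  have e3 := Real.sq_sqrt h3.le
  have e4 := Real.sq_sqrt h4.le
  have p1 := Real.sqrt_pos.mpr h1
  have p2 := Real.sqrt_pos.mpr h2
  have p3 := Real.sqrt_pos.mpr h3
  have p4 := Real.sqrt_pos.mpr h4
  set r1 := √N₁
  set r3 := √N₃
  set r4 := √N₄
  rw [← e1, ← e3, ← e4]
  field_simp

section CommSymbol

variable {s N N₁ N₂ N₃ N₄ : ℝ} {m : Rn 2 → ℝ} {ξ₂ ξ₃ ξ₄ : Rn 2}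

lemma IsAdmissibleMultiplier.abs_commSymbol_le_of_low {C : ℝ}
    (hm : IsAdmissibleMultiplier 2 s m)
    (hC : ∀ η ζ : Rn 2, ‖ζ‖ ≤ 1 / 2 → |m η - m (η + ζ)| ≤ C * (‖ζ‖ / (1 + ‖η‖)) * m η)
    (hC0 : 0 < C) (hN : 1 ≤ N) (h2 : 1 ≤ N₂) (h43 : N₄ ≤ N₃) (hξ2 : N₂ ≤ jap ξ₂)
    (hξ3 : jap ξ₃ ≤ 2 * N₃) (hξ4 : jap ξ₄ ≤ 2 * N₄) (hlow : 8 * N₃ ≤ N) :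
    |commSymbol m N ξ₂ ξ₃ ξ₄| ≤ 4 * C * (N₃ / N₂) := by
  have hN0 : 0 < N := by linarith
  have n3 := norm_le_jap ξ₃
  have n4 := norm_le_jap ξ₄
  have j3 := one_le_jap ξ₃
  rw [commSymbol, hm.mN_eq_one hN0 (ξ := ξ₃) (by linarith),
    hm.mN_eq_one hN0 (ξ := ξ₄) (by linarith), mul_one, mul_one]
  have hp := hm.mN_pos (N := N) ξ₂
  have hz : ‖N⁻¹ • (ξ₃ + ξ₄)‖ ≤ 4 * N₃ / N := by
    rw [norm_inv_smul_eq hN0]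
    gcongr
    linarith [norm_add_le ξ₃ ξ₄]
  have key := hC (N⁻¹ • ξ₂) (N⁻¹ • (ξ₃ + ξ₄)) (hz.trans (by rw [div_le_div_iff₀] <;> linarith))
  have hN3 : 0 < N₃ := by linarith
  have hd : N₂ / N ≤ 1 + ‖N⁻¹ • ξ₂‖ := by
    rw [norm_inv_smul_eq hN0, div_le_iff₀ hN0, add_mul, div_mul_cancel₀ _ hN0.ne']
    linarith [jap_le_one_add_norm ξ₂]
  have hq : ‖N⁻¹ • (ξ₃ + ξ₄)‖ / (1 + ‖N⁻¹ • ξ₂‖) ≤ (4 * N₃ / N) / (N₂ / N) := by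
    gcongr
  have e : 4 * N₃ / N / (N₂ / N) = 4 * (N₃ / N₂) := by field_simp
  rw [e] at hq
  rw [one_sub_div hp.ne', abs_div, abs_of_pos hp, div_le_iff₀ hp, add_assoc]
  have hr : |mN m N ξ₂ - mN m N (ξ₂ + (ξ₃ + ξ₄))| =
      |m (N⁻¹ • ξ₂) - m (N⁻¹ • ξ₂ + N⁻¹ • (ξ₃ + ξ₄))| := by
    simp only [mN, smul_add]
  rw [hr]
  refine key.trans ?_
  have hp' : 0 < m (N⁻¹ • ξ₂) := hp
  calc C * (‖N⁻¹ • (ξ₃ + ξ₄)‖ / (1 + ‖N⁻¹ • ξ₂‖)) * m (N⁻¹ • ξ₂)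
      ≤ C * (4 * (N₃ / N₂)) * m (N⁻¹ • ξ₂) := by gcongr
    _ = 4 * C * (N₃ / N₂) * mN m N ξ₂ := by rw [mN]; ring

lemma IsAdmissibleMultiplier.mN_div_mul_le (hm : IsAdmissibleMultiplier 2 s m)
    (hs0 : 1 / 2 ≤ s) (hs1 : s ≤ 1) (hN : 1 ≤ N) (h1 : 1 ≤ N₁) (h3 : 1 ≤ N₃)
    (h4 : 1 ≤ N₄) (h2 : 1 ≤ N₂) (h12 : N₁ ≤ 6 * N₂)
    (hξ1 : N₁ ≤ jap (ξ₂ + ξ₃ + ξ₄))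
    (hξ2 : jap ξ₂ ≤ 2 * N₂) (hξ3 : jap ξ₃ ≤ 2 * N₃) (hξ4 : jap ξ₄ ≤ 2 * N₄)
    (hhigh : N ≤ 100 * N₃) :
    mN m N (ξ₂ + ξ₃ + ξ₄) / (mN m N ξ₂ * mN m N ξ₃ * mN m N ξ₄) *
      (√N₁ / (N₂ * (√N₂ * √N₃ * √N₄))) ≤ 46080 / (N₂ * √N) := by
  have hN0 : 0 < N := by linarith
  have u1 := hm.mN_le (by linarith) hs1 hN (by linarith) hξ1
  have u2 := hm.le_mN (by linarith) hs1 hN (by linarith) hξ2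
  have u3 := hm.le_mN (by linarith) hs1 hN (by linarith) hξ3
  have u4 := hm.le_mN (by linarith) hs1 hN (by linarith) hξ4
  have a0 : 0 ≤ 1 - s := by linarith
  have a1 : 1 - s ≤ 1 / 2 := by linarith
  have w12 : rootWeight (1 - s) N N₁ ≤ 3 * rootWeight (1 - s) N N₂ :=
    rootWeight_le a0 a1 hN0 (by linarith) (by linarith) (by norm_num) (by linarith)
  have w3 : rootWeight (1 - s) N N ≤ 10 * rootWeight (1 - s) N N₃ :=
    rootWeight_le a0 a1 hN0 (by linarith) (by linarith) (by norm_num) (by linarith)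
  have w4 : rootWeight (1 - s) N 1 ≤ 1 * rootWeight (1 - s) N N₄ :=
    rootWeight_le a0 a1 hN0 (by linarith) (by linarith) (by norm_num) (by linarith)
  have v3 := half_sqrt_le_rootWeight a0 a1 hN0 hN0.le le_rfl
  have v4 := half_sqrt_le_rootWeight a0 a1 hN0 zero_le_one hN
  rw [Real.sqrt_one] at v4
  have p2 := rootWeight_pos (a := 1 - s) hN0 (by linarith : 0 < N₂)
  have p3 := rootWeight_pos (a := 1 - s) hN0 (by linarith : 0 < N₃)
  have x3 : √N / 20 ≤ rootWeight (1 - s) N N₃ := by linarith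
  have x4 : 1 / 2 ≤ rootWeight (1 - s) N N₄ := by linarith
  have q1 : 0 < (1 + N₁ / N) ^ (-(1 - s)) := by positivity
  have q2 : 0 < (1 + N₂ / N) ^ (-(1 - s)) := by positivity
  have q3 : 0 < (1 + N₃ / N) ^ (-(1 - s)) := by positivity
  have q4 : 0 < (1 + N₄ / N) ^ (-(1 - s)) := by positivity
  have r2 : 0 < √N₂ := by positivity
  have r3 : 0 < √N₃ := by positivity
  have r4 : 0 < √N₄ := by positivity
  have rN : 0 < √N := by positivity
  calc mN m N (ξ₂ + ξ₃ + ξ₄) / (mN m N ξ₂ * mN m N ξ₃ * mN m N ξ₄) *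
        (√N₁ / (N₂ * (√N₂ * √N₃ * √N₄)))
      ≤ 6 * (1 + N₁ / N) ^ (-(1 - s)) / ((1 / 4 * (1 + N₂ / N) ^ (-(1 - s))) *
          (1 / 4 * (1 + N₃ / N) ^ (-(1 - s))) * (1 / 4 * (1 + N₄ / N) ^ (-(1 - s)))) *
        (√N₁ / (N₂ * (√N₂ * √N₃ * √N₄))) := by
        have := (hm.mN_pos (N := N) ξ₂).le
        have := (hm.mN_pos (N := N) ξ₃).le
        gcongr
    _ = 384 * (rootWeight (1 - s) N N₁ / (N₂ * (rootWeight (1 - s) N N₂ *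
          rootWeight (1 - s) N N₃ * rootWeight (1 - s) N N₄))) := by
        unfold rootWeight
        field_simp
        norm_num
    _ ≤ 384 * (3 * rootWeight (1 - s) N N₂ / (N₂ * (rootWeight (1 - s) N N₂ *
          (√N / 20) * (1 / 2)))) := by
        gcongr
    _ = _ := by
        field_simp
        norm_num

lemma IsAdmissibleMultiplier.exists_abs_commSymbol_le (hm : IsAdmissibleMultiplier 2 s m)
    (hs0 : 1 / 2 ≤ s) (hs1 : s ≤ 1) : ∃ C : ℝ, 0 < C ∧ ∀ N N₁ N₂ N₃ N₄ : ℝ, 1 ≤ N → 1 ≤ N₁ →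
      1 ≤ N₄ → N₄ ≤ N₃ → N₃ ≤ N₂ → ∀ ξ₂ ξ₃ ξ₄ : Rn 2,
      N₁ ≤ jap (-ξ₂ - ξ₃ - ξ₄) → N₂ ≤ jap ξ₂ → jap ξ₂ ≤ 2 * N₂ → jap ξ₃ ≤ 2 * N₃ →
      jap ξ₄ ≤ 2 * N₄ → commSymbol m N ξ₂ ξ₃ ξ₄ = 0 ∨
      (N ≤ 6 * N₂ ∧ N₁ ≤ 6 * N₂ ∧ |commSymbol m N ξ₂ ξ₃ ξ₄| *
        (√(N₃ / N₁) * √(N₄ / N₂) * (N₁ / (N₂ * N₃ * N₄))) ≤ C / (N₂ * √N)) := by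
  obtain ⟨C, hC0, hC⟩ := hm.exists_lipschitz (by linarith) hs1
  refine ⟨24 * C + 46110, by positivity, ?_⟩
  intro N N₁ N₂ N₃ N₄ hN h1 h4 h43 h32 ξ₂ ξ₃ ξ₄ hξ1 hξ2 hξ2' hξ3 hξ4
  rw [show -ξ₂ - ξ₃ - ξ₄ = -(ξ₂ + ξ₃ + ξ₄) by abel, jap_neg] at hξ1
  have hN0 : 0 < N := by linarith
  have n2 := norm_le_jap ξ₂
  have n3 := norm_le_jap ξ₃
  have n4 := norm_le_jap ξ₄
  have t2 := jap_add_le (ξ₂ + ξ₃) ξ₄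
  have t3 := jap_add_le ξ₂ ξ₃
  have t4 := norm_le_jap (ξ₂ + ξ₃ + ξ₄)
  have h12 : N₁ ≤ 6 * N₂ := by linarith
  rcases le_or_gt (6 * N₂) N with hA | hA
  · left
    rw [commSymbol, hm.mN_eq_one hN0 (ξ := ξ₂) (by linarith),
      hm.mN_eq_one hN0 (ξ := ξ₃) (by linarith), hm.mN_eq_one hN0 (ξ := ξ₄) (by linarith),
      hm.mN_eq_one hN0 (ξ := ξ₂ + ξ₃ + ξ₄) (by linarith)]
    norm_num
  right
  refine ⟨hA.le, h12, ?_⟩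
  rw [sqrt_div_mul_sqrt_div_eq (by linarith) (by linarith) (by linarith) (by linarith)]
  have r2 : 0 < √N₂ := Real.sqrt_pos.mpr (by linarith)
  have r3 : 0 < √N₃ := Real.sqrt_pos.mpr (by linarith)
  have r4 : 1 ≤ √N₄ := Real.one_le_sqrt.mpr h4
  have rN : 0 < √N := by positivity
  have p2 : 0 < N₂ := by linarith
  have p3 : 0 < N₃ := by linarith
  have s1 : √N₁ ≤ √6 * √N₂ := by
    rw [← Real.sqrt_mul (by norm_num)]; exact Real.sqrt_le_sqrt h12
  have s2 : √N ≤ √6 * √N₂ := by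
    rw [← Real.sqrt_mul (by norm_num)]; exact Real.sqrt_le_sqrt hA.le
  have s32 : √N₃ ≤ √N₂ := Real.sqrt_le_sqrt h32
  have s6 : √6 * √6 = (6 : ℝ) := Real.mul_self_sqrt (by norm_num)
  have s6' : 0 < √(6 : ℝ) := by positivity
  have hD : √N₁ / (N₂ * (√N₂ * √N₃ * √N₄)) ≤ √6 / (N₂ * √N₃) := by
    calc √N₁ / (N₂ * (√N₂ * √N₃ * √N₄)) ≤ √6 * √N₂ / (N₂ * (√N₂ * √N₃ * 1)) := by gcongr
      _ = _ := by field_simp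
  rcases le_or_gt (100 * N₃) N with hB | hB
  · have hM := hm.abs_commSymbol_le_of_low hC hC0 hN (by linarith) h43 hξ2 hξ3 hξ4 (by linarith)
    calc |commSymbol m N ξ₂ ξ₃ ξ₄| * (√N₁ / (N₂ * (√N₂ * √N₃ * √N₄)))
        ≤ 4 * C * (N₃ / N₂) * (√6 / (N₂ * √N₃)) := by gcongr
      _ = 4 * C * √6 * √N₃ / (N₂ * N₂) := by
        have := Real.sq_sqrt p3.le
        field_simp
        linarith
      _ ≤ 4 * C * √6 * √N₂ / (N₂ * N₂) := by gcongr
      _ = 4 * C * √6 / (N₂ * √N₂) := by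
        have := Real.sq_sqrt p2.le
        field_simp
        linarith
      _ ≤ 4 * C * √6 / (N₂ * (√N / √6)) := by
        gcongr
        rw [div_le_iff₀ s6']; linarith
      _ = 24 * C / (N₂ * √N) := by
        field_simp
        nlinarith
      _ ≤ _ := by gcongr; linarith
  · have hR := hm.mN_div_mul_le hs0 hs1 hN h1 (by linarith) h4 (by linarith) h12 hξ1 hξ2' hξ3 hξ4
      hB.le
    have hpos : 0 < mN m N (ξ₂ + ξ₃ + ξ₄) / (mN m N ξ₂ * mN m N ξ₃ * mN m N ξ₄) :=
      div_pos (hm.mN_pos _) (mul_pos (mul_pos (hm.mN_pos _) (hm.mN_pos _)) (hm.mN_pos _))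
    have hM : |commSymbol m N ξ₂ ξ₃ ξ₄| ≤
        1 + mN m N (ξ₂ + ξ₃ + ξ₄) / (mN m N ξ₂ * mN m N ξ₃ * mN m N ξ₄) := by
      rw [commSymbol, abs_le]; constructor <;> linarith
    have s3 : √N ≤ 10 * √N₃ := by
      rw [show (10 : ℝ) = √(10 ^ 2) by rw [Real.sqrt_sq (by norm_num)],
        ← Real.sqrt_mul (by norm_num)]
      exact Real.sqrt_le_sqrt (by linarith)
    have s6'' : √(6 : ℝ) ≤ 3 := by nlinarith
    have hD' : √N₁ / (N₂ * (√N₂ * √N₃ * √N₄)) ≤ 30 / (N₂ * √N) := by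
      calc √N₁ / (N₂ * (√N₂ * √N₃ * √N₄)) ≤ √6 / (N₂ * √N₃) := hD
        _ ≤ 3 / (N₂ * (√N / 10)) := by gcongr; linarith
        _ = _ := by field_simp; norm_num
    calc |commSymbol m N ξ₂ ξ₃ ξ₄| * (√N₁ / (N₂ * (√N₂ * √N₃ * √N₄)))
        ≤ (1 + mN m N (ξ₂ + ξ₃ + ξ₄) / (mN m N ξ₂ * mN m N ξ₃ * mN m N ξ₄)) *
          (√N₁ / (N₂ * (√N₂ * √N₃ * √N₄))) := by gcongr
      _ ≤ 30 / (N₂ * √N) + 46080 / (N₂ * √N) := by rw [add_mul, one_mul]; gcongr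
      _ = 46110 / (N₂ * √N) := by rw [← add_div]; norm_num
      _ ≤ _ := by gcongr; linarith

/-- The gain in the commutator estimate, in terms of the highest frequency. -/
lemma one_div_mul_sqrt_le {ε : ℝ} (hε : 0 < ε) (hε1 : ε ≤ 1) (hN : 1 ≤ N) (h1 : 1 ≤ N₁)
    (h4 : 1 ≤ N₄) (h43 : N₄ ≤ N₃) (h32 : N₃ ≤ N₂) (h12 : N₁ ≤ 6 * N₂) (hN2 : N ≤ 6 * N₂) :
    1 / (N₂ * √N) ≤ 6 * (N ^ (-(3 / 2 : ℝ) + ε) * (N₁ * N₂ * N₃ * N₄) ^ (-(ε / 4))) := by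
  have hN0 : 0 < N := by linarith
  have p2 : 0 < N₂ := by linarith
  have p3 : 0 < N₃ := by linarith
  have p4 : 0 < N₄ := by linarith
  have p1 : 0 < N₁ := by linarith
  have hprod : N₁ * N₂ * N₃ * N₄ ≤ (6 * N₂) ^ (4 : ℝ) := by
    have : N₁ * N₂ * N₃ * N₄ ≤ (6 * N₂) * (6 * N₂) * (6 * N₂) * (6 * N₂) := by
      gcongr <;> linarith
    rw [show (4 : ℝ) = (4 : ℕ) by norm_num, Real.rpow_natCast]
    linarith
  have hA : (6 * N₂) ^ (-ε) ≤ (N₁ * N₂ * N₃ * N₄) ^ (-(ε / 4)) := by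
    have := Real.rpow_le_rpow_of_nonpos (by positivity) hprod (by linarith : -(ε / 4) ≤ 0)
    rwa [← Real.rpow_mul (by positivity), show (4 : ℝ) * -(ε / 4) = -ε by ring] at this
  have hB : (6 * N₂) ^ (-(1 - ε)) ≤ N ^ (-(1 - ε)) :=
    Real.rpow_le_rpow_of_nonpos hN0 hN2 (by linarith)
  calc 1 / (N₂ * √N) = 6 * ((6 * N₂) ^ (-(1 - ε)) * (6 * N₂) ^ (-ε)) * N ^ (-(1 / 2) : ℝ) := by
        rw [← Real.rpow_add (by positivity), show -(1 - ε) + -ε = -1 by ring, Real.rpow_neg_one,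
          Real.rpow_neg hN0.le, ← Real.sqrt_eq_rpow]
        field_simp
    _ ≤ 6 * (N ^ (-(1 - ε)) * (N₁ * N₂ * N₃ * N₄) ^ (-(ε / 4))) * N ^ (-(1 / 2) : ℝ) := by
        gcongr
    _ = 6 * (N ^ (-(3 / 2 : ℝ) + ε) * (N₁ * N₂ * N₃ * N₄) ^ (-(ε / 4))) := by
        rw [show -(3 / 2 : ℝ) + ε = -(1 - ε) + -(1 / 2) by ring, Real.rpow_add hN0]
        ring


end CommSymbol

section Measurability

variable {s : ℝ} {m : Rn 2 → ℝ} (N : ℝ)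

lemma IsAdmissibleMultiplier.continuous_mN (hm : IsAdmissibleMultiplier 2 s m) :
    Continuous (mN m N) := hm.1.continuous.comp (continuous_const_smul N⁻¹)

lemma IsAdmissibleMultiplier.continuous_commSymbol (hm : IsAdmissibleMultiplier 2 s m) :
    Continuous fun p : Rn 2 × Rn 2 × Rn 2 => commSymbol m N p.1 p.2.1 p.2.2 := by
  have hc := hm.continuous_mN N
  have h1 : Continuous fun p : Rn 2 × Rn 2 × Rn 2 => mN m N (p.1 + p.2.1 + p.2.2) :=
    hc.comp (by fun_prop)
  have h2 : Continuous fun p : Rn 2 × Rn 2 × Rn 2 => mN m N p.1 := hc.comp (by fun_prop)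
  have h3 : Continuous fun p : Rn 2 × Rn 2 × Rn 2 => mN m N p.2.1 := hc.comp (by fun_prop)
  have h4 : Continuous fun p : Rn 2 × Rn 2 × Rn 2 => mN m N p.2.2 := hc.comp (by fun_prop)
  exact continuous_const.sub (h1.div ((h2.mul h3).mul h4) fun p =>
    (mul_pos (mul_pos (hm.mN_pos _) (hm.mN_pos _)) (hm.mN_pos _)).ne')

end Measurability

/-- The integrand of the commutator form. -/
def commIntegrand (m : Rn 2 → ℝ) (N : ℝ) (φ₁ φ₂ φ₃ φ₄ : SchwartzMap (Rn 2 × ℝ) ℂ) (t : ℝ)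
    (ξ₂ ξ₃ ξ₄ : Rn 2) : ℂ :=
  (commSymbol m N ξ₂ ξ₃ ξ₄ : ℂ) * spaceFourier φ₁ (-ξ₂ - ξ₃ - ξ₄) t * spaceFourier φ₂ ξ₂ t *
    spaceFourier φ₃ ξ₃ t * spaceFourier φ₄ ξ₄ t

/-- The commutator form with absolute values inside. -/
def commForm (m : Rn 2 → ℝ) (N : ℝ) (φ₁ φ₂ φ₃ φ₄ : SchwartzMap (Rn 2 × ℝ) ℂ) : ℝ≥0∞ :=
  ∫⁻ t, ∫⁻ ξ₂, ∫⁻ ξ₃, ∫⁻ ξ₄, ‖commIntegrand m N φ₁ φ₂ φ₃ φ₄ t ξ₂ ξ₃ ξ₄‖ₑ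

section Symmetry

variable {s N : ℝ} {m : Rn 2 → ℝ}

lemma IsAdmissibleMultiplier.continuous_commIntegrand (hm : IsAdmissibleMultiplier 2 s m) (N : ℝ)
    (φ₁ φ₂ φ₃ φ₄ : SchwartzMap (Rn 2 × ℝ) ℂ) (t : ℝ) :
    Continuous fun p : Rn 2 × Rn 2 × Rn 2 =>
      commIntegrand m N φ₁ φ₂ φ₃ φ₄ t p.1 p.2.1 p.2.2 := by
  have hF (φ : SchwartzMap (Rn 2 × ℝ) ℂ) : Continuous fun ξ => spaceFourier φ ξ t := by
    have h := (continuous_spaceFourier φ).comp (Continuous.prodMk_left t)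
    simpa only [Function.comp_def] using h
  have h0 : Continuous fun p : Rn 2 × Rn 2 × Rn 2 =>
      (commSymbol m N p.1 p.2.1 p.2.2 : ℂ) :=
    continuous_ofReal.comp (hm.continuous_commSymbol N)
  have h1 : Continuous fun p : Rn 2 × Rn 2 × Rn 2 =>
      spaceFourier φ₁ (-p.1 - p.2.1 - p.2.2) t := (hF φ₁).comp
    (f := fun p : Rn 2 × Rn 2 × Rn 2 => -p.1 - p.2.1 - p.2.2) (by fun_prop)
  have h2 : Continuous fun p : Rn 2 × Rn 2 × Rn 2 => spaceFourier φ₂ p.1 t :=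
    (hF φ₂).comp
    (f := fun p : Rn 2 × Rn 2 × Rn 2 => p.1) (by fun_prop)
  have h3 : Continuous fun p : Rn 2 × Rn 2 × Rn 2 => spaceFourier φ₃ p.2.1 t :=
    (hF φ₃).comp
    (f := fun p : Rn 2 × Rn 2 × Rn 2 => p.2.1) (by fun_prop)
  have h4 : Continuous fun p : Rn 2 × Rn 2 × Rn 2 => spaceFourier φ₄ p.2.2 t :=
    (hF φ₄).comp
    (f := fun p : Rn 2 × Rn 2 × Rn 2 => p.2.2) (by fun_prop)
  unfold commIntegrand
  exact (((h0.mul h1).mul h2).mul h3).mul h4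

lemma commIntegrand_swap_first (φ₁ φ₂ φ₃ φ₄ : SchwartzMap (Rn 2 × ℝ) ℂ) (t : ℝ)
    (ξ₂ ξ₃ ξ₄ : Rn 2) : commIntegrand m N φ₁ φ₂ φ₃ φ₄ t ξ₂ ξ₃ ξ₄ =
      commIntegrand m N φ₁ φ₃ φ₂ φ₄ t ξ₃ ξ₂ ξ₄ := by
  unfold commIntegrand commSymbol
  rw [add_comm ξ₂ ξ₃, mul_comm (mN m N ξ₂), show -ξ₂ - ξ₃ - ξ₄ = -ξ₃ - ξ₂ - ξ₄ by abel]
  ring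

lemma commIntegrand_swap_last (φ₁ φ₂ φ₃ φ₄ : SchwartzMap (Rn 2 × ℝ) ℂ) (t : ℝ)
    (ξ₂ ξ₃ ξ₄ : Rn 2) : commIntegrand m N φ₁ φ₂ φ₃ φ₄ t ξ₂ ξ₃ ξ₄ =
      commIntegrand m N φ₁ φ₂ φ₄ φ₃ t ξ₂ ξ₄ ξ₃ := by
  unfold commIntegrand commSymbol
  rw [add_right_comm, mul_right_comm (mN m N ξ₂), sub_right_comm (-ξ₂)]
  ring

lemma IsAdmissibleMultiplier.commForm_swap_first (hm : IsAdmissibleMultiplier 2 s m)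
    (φ₁ φ₂ φ₃ φ₄ : SchwartzMap (Rn 2 × ℝ) ℂ) :
    commForm m N φ₁ φ₂ φ₃ φ₄ = commForm m N φ₁ φ₃ φ₂ φ₄ := by
  unfold commForm
  congr with t
  rw [lintegral_lintegral_swap]
  · simp_rw [commIntegrand_swap_first φ₁ φ₂ φ₃ φ₄]
  · refine Measurable.aemeasurable ?_
    have h2 : Continuous fun q : (Rn 2 × Rn 2) × Rn 2 =>
        commIntegrand m N φ₁ φ₂ φ₃ φ₄ t q.1.1 q.1.2 q.2 :=
      (hm.continuous_commIntegrand N φ₁ φ₂ φ₃ φ₄ t).comp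
        (g := fun p : Rn 2 × Rn 2 × Rn 2 => commIntegrand m N φ₁ φ₂ φ₃ φ₄ t p.1 p.2.1 p.2.2)
        (f := fun q : (Rn 2 × Rn 2) × Rn 2 => (q.1.1, q.1.2, q.2)) (by fun_prop)
    exact h2.enorm.measurable.lintegral_prod_right'

lemma IsAdmissibleMultiplier.commForm_swap_last (hm : IsAdmissibleMultiplier 2 s m)
    (φ₁ φ₂ φ₃ φ₄ : SchwartzMap (Rn 2 × ℝ) ℂ) :
    commForm m N φ₁ φ₂ φ₃ φ₄ = commForm m N φ₁ φ₂ φ₄ φ₃ := by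
  unfold commForm
  congr with t
  congr with ξ₂
  rw [lintegral_lintegral_swap]
  · simp_rw [commIntegrand_swap_last φ₁ φ₂ φ₃ φ₄]
  · have h2 : Continuous fun q : Rn 2 × Rn 2 =>
        commIntegrand m N φ₁ φ₂ φ₃ φ₄ t ξ₂ q.1 q.2 :=
      (hm.continuous_commIntegrand N φ₁ φ₂ φ₃ φ₄ t).comp
        (g := fun p : Rn 2 × Rn 2 × Rn 2 => commIntegrand m N φ₁ φ₂ φ₃ φ₄ t p.1 p.2.1 p.2.2)
        (f := fun q : Rn 2 × Rn 2 => (ξ₂, q.1, q.2)) (by fun_prop)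
    exact h2.enorm.measurable.aemeasurable

end Symmetry

section CommutatorEstimate

variable {s : ℝ} {m : Rn 2 → ℝ}

/-- The right-hand side of the commutator estimate, up to a constant. -/
def commBound (ε N M₁ M₂ M₃ M₄ : ℝ) (φ₁ φ₂ φ₃ φ₄ : SchwartzMap (Rn 2 × ℝ) ℂ) : ℝ :=
  N ^ (-(3 / 2 : ℝ) + ε) * (M₁ * M₂ * M₃ * M₄) ^ (-(ε / 4)) *
    (XNorm 2 (-1) (1 / 2 + ε) (fun x t => φ₁ (x, t)) *
      XNorm 2 1 (1 / 2 + ε) (fun x t => φ₂ (x, t)) *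
      XNorm 2 1 (1 / 2 + ε) (fun x t => φ₃ (x, t)) *
      XNorm 2 1 (1 / 2 + ε) (fun x t => φ₄ (x, t)))

lemma commBound_swap_first (ε N M₁ M₂ M₃ M₄ : ℝ) (φ₁ φ₂ φ₃ φ₄ : SchwartzMap (Rn 2 × ℝ) ℂ) :
    commBound ε N M₁ M₂ M₃ M₄ φ₁ φ₂ φ₃ φ₄ = commBound ε N M₁ M₃ M₂ M₄ φ₁ φ₃ φ₂ φ₄ := by
  unfold commBound
  rw [mul_right_comm M₁ M₂]
  ring

lemma commBound_swap_last (ε N M₁ M₂ M₃ M₄ : ℝ) (φ₁ φ₂ φ₃ φ₄ : SchwartzMap (Rn 2 × ℝ) ℂ) :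
    commBound ε N M₁ M₂ M₃ M₄ φ₁ φ₂ φ₃ φ₄ = commBound ε N M₁ M₂ M₄ M₃ φ₁ φ₂ φ₄ φ₃ := by
  unfold commBound
  rw [mul_right_comm (M₁ * M₂) M₃]
  ring

lemma IsAdmissibleMultiplier.exists_commForm_le_of_ordered (hm : IsAdmissibleMultiplier 2 s m)
    (hs0 : 1 / 2 ≤ s) (hs1 : s ≤ 1) {ε : ℝ} (hε : 0 < ε) (hε1 : ε ≤ 1 / 2) :
    ∃ C : ℝ, 0 < C ∧ ∀ N M₁ M₂ M₃ M₄ : ℝ, 1 ≤ N → 1 ≤ M₁ → 1 ≤ M₄ → M₄ ≤ M₃ → M₃ ≤ M₂ →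
      ∀ φ₁ φ₂ φ₃ φ₄ : SchwartzMap (Rn 2 × ℝ) ℂ, IsNonnegLocalized M₁ φ₁ →
      IsNonnegLocalized M₂ φ₂ → IsNonnegLocalized M₃ φ₃ → IsNonnegLocalized M₄ φ₄ →
      commForm m N φ₁ φ₂ φ₃ φ₄ ≤
        ENNReal.ofReal (C * commBound ε N M₁ M₂ M₃ M₄ φ₁ φ₂ φ₃ φ₄) := by
  obtain ⟨C, hC, h⟩ := exists_lintegral_enorm_spaceFourier_le (b := 1 / 2 + ε) (by linarith)
    (by linarith)
  obtain ⟨K, hK, hsymb⟩ := hm.exists_abs_commSymbol_le hs0 hs1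
  refine ⟨6 * K * C, by positivity, ?_⟩
  intro N M₁ M₂ M₃ M₄ hN h1 h4 h43 h32 φ₁ φ₂ φ₃ φ₄ l1 l2 l3 l4
  have h3 : 1 ≤ M₃ := h4.trans h43
  have h2 : 1 ≤ M₂ := h3.trans h32
  set W := √(M₃ / M₁) * √(M₄ / M₂) * (M₁ / (M₂ * M₃ * M₄)) with hW
  have hW0 : 0 < W := by positivity
  set G := N ^ (-(3 / 2 : ℝ) + ε) * (M₁ * M₂ * M₃ * M₄) ^ (-(ε / 4)) with hG
  have hG0 : 0 < G := by positivity
  have hpt : ∀ t ξ₂ ξ₃ ξ₄, ‖commIntegrand m N φ₁ φ₂ φ₃ φ₄ t ξ₂ ξ₃ ξ₄‖ₑ ≤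
      ENNReal.ofReal (6 * K * G / W) * ‖spaceFourier φ₁ (-ξ₂ - ξ₃ - ξ₄) t *
        spaceFourier φ₂ ξ₂ t * spaceFourier φ₃ ξ₃ t * spaceFourier φ₄ ξ₄ t‖ₑ := by
    intro t ξ₂ ξ₃ ξ₄
    have e : commIntegrand m N φ₁ φ₂ φ₃ φ₄ t ξ₂ ξ₃ ξ₄ = (commSymbol m N ξ₂ ξ₃ ξ₄ : ℂ) *
        (spaceFourier φ₁ (-ξ₂ - ξ₃ - ξ₄) t * spaceFourier φ₂ ξ₂ t * spaceFourier φ₃ ξ₃ t *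
          spaceFourier φ₄ ξ₄ t) := by
      unfold commIntegrand; ring
    rw [e, enorm_mul]
    by_cases hz : spaceFourier φ₁ (-ξ₂ - ξ₃ - ξ₄) t * spaceFourier φ₂ ξ₂ t *
        spaceFourier φ₃ ξ₃ t * spaceFourier φ₄ ξ₄ t = 0
    · simp [hz]
    gcongr
    obtain ⟨⟨⟨z1, z2⟩, z3⟩, z4⟩ := by simpa only [mul_ne_zero_iff] using hz
    rw [← ofReal_norm, Complex.norm_real, Real.norm_eq_abs]
    apply ENNReal.ofReal_le_ofReal
    rcases hsymb N M₁ M₂ M₃ M₄ hN h1 h4 h43 h32 ξ₂ ξ₃ ξ₄ (l1.support _ _ z1).1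
      (l2.support _ _ z2).1 (l2.support _ _ z2).2 (l3.support _ _ z3).2
      (l4.support _ _ z4).2 with h0 | ⟨hN2, h12, hb⟩
    · rw [h0, abs_zero]; positivity
    · rw [le_div_iff₀ hW0]
      refine hb.trans ?_
      have := one_div_mul_sqrt_le hε (by linarith) hN h1 h4 h43 h32 h12 hN2
      calc K / (M₂ * √N) = K * (1 / (M₂ * √N)) := by ring
        _ ≤ K * (6 * G) := by gcongr
        _ = _ := by ring
  calc commForm m N φ₁ φ₂ φ₃ φ₄
      ≤ ∫⁻ t, ∫⁻ ξ₂, ∫⁻ ξ₃, ∫⁻ ξ₄, ENNReal.ofReal (6 * K * G / W) *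
        ‖spaceFourier φ₁ (-ξ₂ - ξ₃ - ξ₄) t * spaceFourier φ₂ ξ₂ t * spaceFourier φ₃ ξ₃ t *
          spaceFourier φ₄ ξ₄ t‖ₑ :=
        lintegral_mono fun t => lintegral_mono fun ξ₂ => lintegral_mono fun ξ₃ =>
          lintegral_mono fun ξ₄ => hpt t ξ₂ ξ₃ ξ₄
    _ = ENNReal.ofReal (6 * K * G / W) * ∫⁻ t, ∫⁻ ξ₂, ∫⁻ ξ₃, ∫⁻ ξ₄,
        ‖spaceFourier φ₁ (-ξ₂ - ξ₃ - ξ₄) t * spaceFourier φ₂ ξ₂ t * spaceFourier φ₃ ξ₃ t *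
          spaceFourier φ₄ ξ₄ t‖ₑ := by
        simp_rw [lintegral_const_mul' _ _ ENNReal.ofReal_ne_top]
    _ ≤ _ := mul_le_mul_right (h M₁ M₂ M₃ M₄ h1 h2 h3 h4 φ₁ φ₂ φ₃ φ₄ l1 l2 l3 l4) _
    _ = _ := by
        rw [← ENNReal.ofReal_mul (by positivity), commBound, ← hG, ← hW]
        congr 1
        field_simp

lemma IsAdmissibleMultiplier.exists_commForm_le (hm : IsAdmissibleMultiplier 2 s m)
    (hs0 : 1 / 2 ≤ s) (hs1 : s ≤ 1) {ε : ℝ} (hε : 0 < ε) (hε1 : ε ≤ 1 / 2) :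
    ∃ C : ℝ, 0 < C ∧ ∀ N M₁ M₂ M₃ M₄ : ℝ, 1 ≤ N → 1 ≤ M₁ → 1 ≤ M₂ → 1 ≤ M₃ → 1 ≤ M₄ →
      ∀ φ₁ φ₂ φ₃ φ₄ : SchwartzMap (Rn 2 × ℝ) ℂ, IsNonnegLocalized M₁ φ₁ →
      IsNonnegLocalized M₂ φ₂ → IsNonnegLocalized M₃ φ₃ → IsNonnegLocalized M₄ φ₄ →
      commForm m N φ₁ φ₂ φ₃ φ₄ ≤
        ENNReal.ofReal (C * commBound ε N M₁ M₂ M₃ M₄ φ₁ φ₂ φ₃ φ₄) := by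
  obtain ⟨C, hC, h⟩ := hm.exists_commForm_le_of_ordered hs0 hs1 hε hε1
  refine ⟨C, hC, ?_⟩
  intro N M₁ M₂ M₃ M₄ hN h1 h2 h3 h4 φ₁ φ₂ φ₃ φ₄ l1 l2 l3 l4
  rcases le_total M₃ M₂ with h32 | h23 <;> rcases le_total M₄ M₃ with h43 | h34 <;>
    rcases le_total M₄ M₂ with h42 | h24
  · exact h _ _ _ _ _ hN h1 h4 h43 h32 _ _ _ _ l1 l2 l3 l4
  · exact h _ _ _ _ _ hN h1 h4 h43 h32 _ _ _ _ l1 l2 l3 l4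
  · rw [hm.commForm_swap_last, commBound_swap_last]
    exact h _ _ _ _ _ hN h1 h3 h34 h42 _ _ _ _ l1 l2 l4 l3
  · rw [hm.commForm_swap_last, hm.commForm_swap_first, commBound_swap_last, commBound_swap_first]
    exact h _ _ _ _ _ hN h1 h3 h32 h24 _ _ _ _ l1 l4 l2 l3
  · rw [hm.commForm_swap_first, commBound_swap_first]
    exact h _ _ _ _ _ hN h1 h4 h42 h23 _ _ _ _ l1 l3 l2 l4
  · rw [hm.commForm_swap_first, hm.commForm_swap_last, commBound_swap_first, commBound_swap_last]
    exact h _ _ _ _ _ hN h1 h2 h24 h43 _ _ _ _ l1 l3 l4 l2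
  · rw [hm.commForm_swap_last, hm.commForm_swap_first, hm.commForm_swap_last, commBound_swap_last,
      commBound_swap_first, commBound_swap_last]
    exact h _ _ _ _ _ hN h1 h2 h23 h34 _ _ _ _ l1 l4 l3 l2
  · rw [hm.commForm_swap_last, hm.commForm_swap_first, hm.commForm_swap_last, commBound_swap_last,
      commBound_swap_first, commBound_swap_last]
    exact h _ _ _ _ _ hN h1 h2 h23 h34 _ _ _ _ l1 l4 l3 l2

end CommutatorEstimate

lemma enorm_setIntegral_commIntegrand_le (m : Rn 2 → ℝ) (N : ℝ)
    (φ₁ φ₂ φ₃ φ₄ : SchwartzMap (Rn 2 × ℝ) ℂ) (S : Set ℝ) :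
    ‖∫ t in S, ∫ ξ₂, ∫ ξ₃, ∫ ξ₄, commIntegrand m N φ₁ φ₂ φ₃ φ₄ t ξ₂ ξ₃ ξ₄‖ₑ ≤
      commForm m N φ₁ φ₂ φ₃ φ₄ := by
  refine (enorm_integral_le_lintegral_enorm _).trans
    ((setLIntegral_le_lintegral _ _).trans (lintegral_mono fun t => ?_))
  refine (enorm_integral_le_lintegral_enorm _).trans (lintegral_mono fun ξ₂ => ?_)
  refine (enorm_integral_le_lintegral_enorm _).trans (lintegral_mono fun ξ₃ => ?_)
  exact enorm_integral_le_lintegral_enorm _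

/-- Frequency-localized commutator estimate in ℝ^{2+1}. -/
theorem statement_10 :
    ∀ s : ℝ, 4/7 < s → s < 1 →
    ∀ m₁ : Rn 2 → ℝ, IsAdmissibleMultiplier 2 s m₁ →
    ∃ ε₀ > (0:ℝ), ∀ ε : ℝ, 0 < ε → ε < ε₀ →
    ∃ ε' > (0:ℝ), ∃ C > (0:ℝ),
    ∀ N : ℝ, 1 ≤ N → ∀ δ : ℝ, 0 < δ → δ ≤ 1 →
    ∀ k : Fin 4 → ℕ, ∀ φ : Fin 4 → SchwartzMap (Rn 2 × ℝ) ℂ,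
    (∀ i : Fin 4, ∀ t : ℝ, ∀ ξ : Rn 2,
        0 ≤ (𝓕 (fun x => φ i (x, t)) ξ).re ∧ (𝓕 (fun x => φ i (x, t)) ξ).im = 0) →
    (∀ i : Fin 4, ∀ t : ℝ, Function.support (fun ξ => 𝓕 (fun x => φ i (x, t)) ξ) ⊆
        {ξ : Rn 2 | (2:ℝ) ^ (k i) ≤ jap ξ ∧ jap ξ ≤ 2 * (2:ℝ) ^ (k i)}) →
    ‖∫ t in Icc (0:ℝ) δ, ∫ ξ₂ : Rn 2, ∫ ξ₃ : Rn 2, ∫ ξ₄ : Rn 2,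
        ((1 - mN m₁ N (ξ₂ + ξ₃ + ξ₄) /
            (mN m₁ N ξ₂ * mN m₁ N ξ₃ * mN m₁ N ξ₄) : ℝ) : ℂ) *
          𝓕 (fun x => φ 0 (x, t)) (-ξ₂ - ξ₃ - ξ₄) *
          𝓕 (fun x => φ 1 (x, t)) ξ₂ *
          𝓕 (fun x => φ 2 (x, t)) ξ₃ *
          𝓕 (fun x => φ 3 (x, t)) ξ₄‖
      ≤ C * N ^ (-(3/2 : ℝ) + ε) *
          ((2:ℝ) ^ (k 0) * (2:ℝ) ^ (k 1) * (2:ℝ) ^ (k 2) * (2:ℝ) ^ (k 3)) ^ (-ε') *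
          XNorm 2 (-1) (1/2 + ε) (fun x t => φ 0 (x, t)) *
          XNorm 2 1 (1/2 + ε) (fun x t => φ 1 (x, t)) *
          XNorm 2 1 (1/2 + ε) (fun x t => φ 2 (x, t)) *
          XNorm 2 1 (1/2 + ε) (fun x t => φ 3 (x, t)) := by
  intro s hs0 hs1 m hm
  refine ⟨1 / 4, by norm_num, fun ε hε hε1 => ⟨ε / 4, by positivity, ?_⟩⟩
  obtain ⟨C, hC, h⟩ := hm.exists_commForm_le (by linarith) hs1.le hε (by linarith)
  refine ⟨C, hC, fun N hN δ _ _ k φ hnonneg hsupp => ?_⟩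
  have hl (i : Fin 4) : IsNonnegLocalized ((2 : ℝ) ^ k i) (φ i) :=
    ⟨fun ξ t => hnonneg i t ξ, fun ξ t hξ => hsupp i t hξ⟩
  have hk (i : Fin 4) : (1 : ℝ) ≤ 2 ^ k i := one_le_pow₀ one_le_two
  have key := (enorm_setIntegral_commIntegrand_le m N (φ 0) (φ 1) (φ 2) (φ 3) (Icc 0 δ)).trans
    (h N _ _ _ _ hN (hk 0) (hk 1) (hk 2) (hk 3) _ _ _ _ (hl 0) (hl 1) (hl 2) (hl 3))
  have hX (i : Fin 4) (r b : ℝ) : 0 ≤ XNorm 2 r b (fun x t => φ i (x, t)) := XNorm_nonneg _ _ _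
  have hB : 0 ≤ C * commBound ε N (2 ^ k 0) (2 ^ k 1) (2 ^ k 2) (2 ^ k 3)
      (φ 0) (φ 1) (φ 2) (φ 3) := by
    unfold commBound
    exact mul_nonneg hC.le (mul_nonneg (by positivity) (mul_nonneg (mul_nonneg (mul_nonneg
      (hX 0 _ _) (hX 1 _ _)) (hX 2 _ _)) (hX 3 _ _)))
  rw [← ofReal_norm, ENNReal.ofReal_le_ofReal_iff hB] at key
  refine key.trans_eq ?_
  unfold commBound
  ring

end
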